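/- For every integer n ≥ 0: N(1,8;4n+2) = C(2,8;4n+2) and N(1,8;4n+3) = C(2,8;4n+3). -/

import Mathlib

/-- The rank of a partition: its largest part minus its number of parts. -/
def partitionRank {n : ℕ} (π : n.Partition) : ℤ :=
  (π.parts.sup : ℤ) - π.parts.card

/-- The crank of a partition: the largest part if there are no parts equal to 1,
otherwise the number of parts larger than the number of ones minus the number of ones. -/
def partitionCrank {n : ℕ} (π : n.Partition) : ℤ :=
  if π.parts.count 1 = 0 then (π.parts.sup : ℤ)
  else ((π.parts.filter (fun x => π.parts.count 1 < x)).card : ℤ) - π.parts.count 1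

/-- `N(a,M;n)`: the number of partitions of `n` whose rank is congruent to `a` modulo `M`. -/
def rankCount (a : ℤ) (M : ℕ) (n : ℕ) : ℕ :=
  (Finset.univ.filter (fun π : n.Partition => partitionRank π % M = a % M)).card

/-- `C(a,M;n)`: the number of partitions of `n` whose crank is congruent to `a` modulo `M`. -/
def crankCount (a : ℤ) (M : ℕ) (n : ℕ) : ℕ :=
  (Finset.univ.filter (fun π : n.Partition => partitionCrank π % M = a % M)).card

open Filter Topology

theorem HasSum.cg {ι : Type*} {f g : ι → ℂ} {a b : ℂ} (h : HasSum f a) (hf : ∀ n, g n = f n) (ha : b = a) :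
    HasSum g b := by
  rw [ha, show g = f from funext hf]; exact h

theorem summable_natAbs_pow {r : ℝ} (h0 : 0 ≤ r) (h1 : r < 1) : Summable fun n : ℤ => r ^ n.natAbs := by
  apply Summable.of_nat_of_neg
  · simpa using summable_geometric_of_lt_one h0 h1
  · simpa using summable_geometric_of_lt_one h0 h1

/-- Summability of Gaussian type sums. -/
theorem summable_gauss_real {r : ℝ} (h0 : 0 < r) (h1 : r < 1) (a b c : ℤ) (ha : 0 < a) :
    Summable fun n : ℤ => r ^ (a * n ^ 2 + b * n + c) := by
  have h : ∀ n : ℤ, r ^ (a * n ^ 2 + b * n + c) ≤ r ^ (c - (|b| + 1) ^ 2) * r ^ n.natAbs := by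
    intro n
    rw [← zpow_natCast, ← zpow_add₀ h0.ne']
    apply zpow_le_zpow_right_of_le_one₀ h0 h1.le
    rw [Int.natCast_natAbs]
    have h2 : -(|b| * |n|) ≤ b * n := by rw [← abs_mul]; exact neg_abs_le _
    have h3 : n ^ 2 = |n| ^ 2 := (sq_abs n).symm
    have h4 : 0 ≤ |n| := abs_nonneg n
    have h5 : 0 ≤ |b| := abs_nonneg b
    have h6 : |n| ^ 2 ≤ a * n ^ 2 := by rw [h3]; nlinarith [sq_nonneg |n|]
    nlinarith [sq_nonneg (|n| - (|b| + 1)), mul_nonneg h4 h5]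
  exact Summable.of_nonneg_of_le (fun n => (zpow_pos h0 _).le) h
    ((summable_natAbs_pow h0.le h1).mul_left _)

theorem summable_gauss {t : ℂ} (h0 : t ≠ 0) (h1 : ‖t‖ < 1) (a b c : ℤ) (ha : 0 < a)
    (f : ℤ → ℂ) (C : ℝ) (hf : ∀ n, ‖f n‖ ≤ C * ‖t‖ ^ (a * n ^ 2 + b * n + c)) :
    Summable f := 
  Summable.of_norm_bounded ((summable_gauss_real (norm_pos_iff.2 h0) h1 a b c ha).mul_left C) hf

/-- finite q-Pochhammer -/
noncomputable def qf (a q : ℂ) (N : ℕ) : ℂ := ∏ i ∈ Finset.range N, (1 - a * q ^ i)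
/-- infinite q-Pochhammer -/
noncomputable def qp (a q : ℂ) : ℂ := ∏' i : ℕ, (1 - a * q ^ i)

theorem qp_summable (a : ℂ) {q : ℂ} (h1 : ‖q‖ < 1) : Summable fun i : ℕ => ‖-(a * q ^ i)‖ := by
  simp only [norm_neg, norm_mul, norm_pow]
  exact (summable_geometric_of_lt_one (norm_nonneg _) h1).mul_left _

theorem qp_multipliable (a : ℂ) {q : ℂ} (h1 : ‖q‖ < 1) : Multipliable fun i : ℕ => (1 - a * q ^ i) := by
  simpa [sub_eq_add_neg] using multipliable_one_add_of_summable (qp_summable a h1)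

theorem qf_tendsto (a : ℂ) {q : ℂ} (h1 : ‖q‖ < 1) : Tendsto (qf a q) atTop (𝓝 (qp a q)) :=
  (qp_multipliable a h1).hasProd.tendsto_prod_nat

theorem qp_ne_zero {a q : ℂ} (h1 : ‖q‖ < 1) (h : ∀ i : ℕ, 1 - a * q ^ i ≠ 0) : qp a q ≠ 0 := by
  have := tprod_one_add_ne_zero_of_summable (f := fun i : ℕ => -(a * q ^ i))
    (by simpa [sub_eq_add_neg] using h) (qp_summable a h1)
  simpa [qp, sub_eq_add_neg] using this

theorem qf_ne_zero {a q : ℂ} (N : ℕ) (h : ∀ i : ℕ, 1 - a * q ^ i ≠ 0) : qf a q N ≠ 0 := 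
  Finset.prod_ne_zero_iff.2 fun i _ => h i

theorem one_sub_pow_ne {q : ℂ} (h1 : ‖q‖ < 1) (i : ℕ) : 1 - q * q ^ i ≠ 0 := by
  intro h
  have : ‖q ^ (i+1)‖ = 1 := by rw [pow_succ', ← sub_eq_zero.1 h]; simp
  rw [norm_pow] at this
  have := pow_lt_one₀ (norm_nonneg q) h1 (Nat.succ_ne_zero i)
  simp_all

theorem qf_succ (a q : ℂ) (N : ℕ) : qf a q (N+1) = qf a q N * (1 - a * q ^ N) := 
  Finset.prod_range_succ _ _

theorem qf_zero (a q : ℂ) : qf a q 0 = 1 := rfl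

/-- reciprocal of (q;q)_m extended by 0 to negative m -/
noncomputable def iq (q : ℂ) (m : ℤ) : ℂ := if m < 0 then 0 else (qf q q m.toNat)⁻¹

theorem iq_rec {q : ℂ} (h1 : ‖q‖ < 1) (m : ℤ) : iq q (m - 1) = (1 - q ^ m) * iq q m := by
  rcases lt_trichotomy m 0 with h | h | h
  · simp [iq, h, (by omega : m < 1)]
  · subst h; simp [iq]
  · obtain ⟨k, rfl⟩ : ∃ k : ℕ, m = k + 1 := ⟨(m-1).toNat, by omega⟩
    have e1 : ((k:ℤ)+1).toNat = k + 1 := by omega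
    have := one_sub_pow_ne h1 k
    have hz : q ^ ((k:ℤ)+1) = q * q ^ k := by
      rw [show (k:ℤ)+1 = ((k+1:ℕ):ℤ) by push_cast; rfl, zpow_natCast, pow_succ']
    simp only [iq, add_sub_cancel_right, e1, qf_succ, hz]
    rw [if_neg (by omega), if_neg (by omega), Int.toNat_natCast, mul_inv]
    field_simp

theorem qfq_ne {q : ℂ} (h1 : ‖q‖ < 1) (N : ℕ) : qf q q N ≠ 0 := qf_ne_zero N (one_sub_pow_ne h1)
theorem qpq_ne {q : ℂ} (h1 : ‖q‖ < 1) : qp q q ≠ 0 := qp_ne_zero h1 (one_sub_pow_ne h1)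

theorem iq_tendsto {q : ℂ} (h1 : ‖q‖ < 1) : Tendsto (iq q) atTop (𝓝 (qp q q)⁻¹) := by
  have h := ((qf_tendsto q h1).inv₀ (qpq_ne h1)).comp
    (tendsto_atTop.2 fun b => eventually_atTop.2 ⟨(b:ℤ), fun m h => by omega⟩ : Tendsto Int.toNat atTop atTop)
  refine h.congr' ?_
  filter_upwards [eventually_ge_atTop 0] with m hm
  simp [iq, hm.not_gt]

theorem iq_bound {q : ℂ} (h1 : ‖q‖ < 1) : ∃ M : ℝ, 0 ≤ M ∧ ∀ m, ‖iq q m‖ ≤ M := by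
  have h := ((qf_tendsto q h1).inv₀ (qpq_ne h1)).norm.bddAbove_range
  obtain ⟨M, hM⟩ := h
  have hM' : ∀ n, ‖(qf q q n)⁻¹‖ ≤ M := fun n => hM ⟨n, rfl⟩
  have h0 := (norm_nonneg _).trans (hM' 0)
  refine ⟨M, h0, fun m => ?_⟩
  unfold iq; split_ifs
  · simpa using h0
  · exact hM' _

theorem qp_rec (a : ℂ) {q : ℂ} (h1 : ‖q‖ < 1) : qp a q = (1 - a) * qp (a * q) q := by
  have h := tprod_eq_zero_mul' (f := fun i : ℕ => (1 - a * q ^ i))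
    (by simpa [pow_succ', mul_assoc] using qp_multipliable (a*q) h1)
  simpa [qp, pow_succ', mul_assoc] using h

theorem norm_sq_lt {q : ℂ} (h1 : ‖q‖ < 1) : ‖q ^ 2‖ < 1 := by
  rw [norm_pow]; exact pow_lt_one₀ (norm_nonneg q) h1 two_ne_zero

theorem qp_split (a : ℂ) {q : ℂ} (h1 : ‖q‖ < 1) : qp a q = qp a (q^2) * qp (a * q) (q^2) := by
  have h := tprod_even_mul_odd (f := fun i : ℕ => (1 - a * q ^ i))
    (by simpa [pow_mul] using qp_multipliable a (norm_sq_lt h1))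
    (by simpa [pow_mul, pow_succ', mul_assoc] using qp_multipliable (a*q) (norm_sq_lt h1))
  rw [qp, ← h]
  simp [qp, pow_mul, pow_succ', mul_assoc]

theorem qp_mul_neg (a : ℂ) {q : ℂ} (h1 : ‖q‖ < 1) : qp a q * qp (-a) q = qp (a^2) (q^2) := by
  rw [qp, qp, qp, ← (qp_multipliable a h1).tprod_mul (qp_multipliable (-a) h1)]
  congr 1; ext i; ring

/-- theta term -/
noncomputable def w (z t : ℂ) (n : ℤ) : ℂ := (-z) ^ n * t ^ (n * (n - 1))

/-- finite weight -/
noncomputable def cN (q : ℂ) (N n : ℤ) : ℂ := iq q (N - n) * iq q (N + n)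

theorem cN_bound {q : ℂ} (h1 : ‖q‖ < 1) : ∃ M : ℝ, 0 ≤ M ∧ ∀ N n, ‖cN q N n‖ ≤ M := by
  obtain ⟨M, h0, hM⟩ := iq_bound h1
  refine ⟨M * M, by positivity, fun N n => ?_⟩
  rw [cN, norm_mul]
  exact mul_le_mul (hM _) (hM _) (norm_nonneg _) h0

theorem cN_tendsto {q : ℂ} (h1 : ‖q‖ < 1) (n : ℤ) :
    Tendsto (fun N : ℕ => cN q N n) atTop (𝓝 ((qp q q)⁻¹ * (qp q q)⁻¹)) := by
  apply Tendsto.mul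
  · exact (iq_tendsto h1).comp (tendsto_atTop.2 fun b => eventually_atTop.2 ⟨(b + n).toNat, fun m h => by omega⟩)
  · exact (iq_tendsto h1).comp (tendsto_atTop.2 fun b => eventually_atTop.2 ⟨(b - n).toNat, fun m h => by omega⟩)

theorem cN_zero {q : ℂ} (n : ℤ) (hn : n ≠ 0) : cN q 0 n = 0 := by
  rcases lt_or_gt_of_ne hn with h | h
  · simp [cN, iq, h]
  · simp [cN, iq, h]

theorem cN_00 {q : ℂ} : cN q 0 0 = 1 := by simp [cN, iq, qf]

theorem w_norm {z t : ℂ} (ht : t ≠ 0) (h1 : ‖t‖ < 1) (hz : z ≠ 0) :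
    Summable fun n : ℤ => ‖w z t n‖ := by
  -- choose k with ‖t‖^k ≤ ‖z‖ ≤ ‖t‖^(-k)
  have tp := norm_pos_iff.2 ht
  have zp := norm_pos_iff.2 hz
  obtain ⟨k, hk⟩ := exists_pow_lt_of_lt_one zp h1
  obtain ⟨l, hl⟩ := exists_pow_lt_of_lt_one (inv_pos.2 zp) h1
  have key : ∀ n : ℤ, ‖w z t n‖ ≤ ‖t‖ ^ (1 * n ^ 2 + (-1-l:ℤ) * n + 0) + ‖t‖ ^ (1 * n ^ 2 + (-1 + k:ℤ) * n + 0) := by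
    intro n
    have e : ‖w z t n‖ = ‖z‖ ^ n * ‖t‖ ^ (n * (n-1)) := by
      rw [w, norm_mul, norm_zpow, norm_zpow, norm_neg]
    rw [e]
    rcases le_total 0 n with h | h
    · apply le_add_of_le_of_nonneg _ (zpow_pos tp _).le
      have : ‖z‖ ^ n ≤ (‖t‖ ^ (-l:ℤ)) ^ n := by
        apply zpow_le_zpow_left₀ h zp.le
        rw [zpow_neg, zpow_natCast, le_inv_comm₀ zp (by positivity)]; exact hl.le
      refine (mul_le_mul_of_nonneg_right this (zpow_pos tp _).le).trans (le_of_eq ?_)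
      rw [← zpow_mul, ← zpow_add₀ tp.ne']; congr 1; ring
    · apply le_add_of_nonneg_of_le (zpow_pos tp _).le
      have : ‖z‖ ^ n ≤ (‖t‖ ^ (k:ℤ)) ^ n := by
        rw [← neg_neg n, zpow_neg, zpow_neg _ (-n)]
        apply inv_anti₀ (by positivity)
        apply zpow_le_zpow_left₀ (by omega) (by positivity)
        rw [zpow_natCast]; exact hk.le
      refine (mul_le_mul_of_nonneg_right this (zpow_pos tp _).le).trans (le_of_eq ?_)
      rw [← zpow_mul, ← zpow_add₀ tp.ne']; congr 1; ring
  exact Summable.of_nonneg_of_le (fun n => norm_nonneg _) key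
    ((summable_gauss_real tp h1 _ _ _ one_pos).add (summable_gauss_real tp h1 _ _ _ one_pos))

theorem wc_summable {z t : ℂ} (ht : t ≠ 0) (h1 : ‖t‖ < 1) (hz : z ≠ 0) (N : ℤ) :
    Summable fun n : ℤ => w z t n * cN (t^2) N n := by
  obtain ⟨M, h0, hM⟩ := cN_bound (norm_sq_lt h1)
  refine Summable.of_norm_bounded ((w_norm ht h1 hz).mul_left M) fun n => ?_
  rw [norm_mul, mul_comm]
  exact mul_le_mul_of_nonneg_right (hM _ _) (norm_nonneg _)

theorem jtp_fin {z t : ℂ} (ht : t ≠ 0) (h1 : ‖t‖ < 1) (hz : z ≠ 0) (N : ℕ) :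
    (∑' n : ℤ, w z t n * cN (t^2) N n) * qf (t^2) (t^2) (2*N) = qf z (t^2) N * qf (t^2/z) (t^2) N := by
  induction N with
  | zero =>
    rw [tsum_eq_single 0]
    · simp [w, cN_00, qf_zero]
    · intro n hn; simp [cN_zero n hn]
  | succ N ih =>
    have hq : t^2 ≠ 0 := pow_ne_zero _ ht
    have hs := (wc_summable ht h1 hz N).hasSum
    have hs1 := (Equiv.subRight (1:ℤ)).hasSum_iff.2 hs
    have hs2 := (Equiv.addRight (1:ℤ)).hasSum_iff.2 hs
    have hc := ((hs.mul_left (1 + (t^2)^(2*N+1))).sub (hs1.mul_left (z * (t^2)^N))).sub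
      (hs2.mul_left ((t^2)^(N+1)/z))
    have hd := (wc_summable ht h1 hz (N+1)).hasSum.mul_left ((1-(t^2)^(2*N+1))*(1-(t^2)^(2*N+2)))
    have key : (1-(t^2)^(2*N+1))*(1-(t^2)^(2*N+2)) * (∑' n : ℤ, w z t n * cN (t^2) (N+1) n) =
      (∑' n : ℤ, w z t n * cN (t^2) N n) * ((1 - z * (t^2)^N)*(1 - t^2/z*(t^2)^N)) := by
      refine HasSum.unique hd (hc.cg ?_ ?_)
      · intro n
        simp only [Function.comp, Equiv.coe_addRight, Equiv.subRight_apply]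
        have hx : (t^2)^n ≠ 0 := zpow_ne_zero _ hq
        have e1 : w z t (n-1) = - w z t n / z * t^2 / (t^2)^n := by
          rw [w, w, zpow_sub_one₀ (neg_ne_zero.2 hz), show (n-1)*(n-1-1) = n*(n-1) + 2 - 2 * n by ring,
            zpow_sub₀ ht, zpow_add₀ ht, zpow_mul t 2 n]
          norm_cast
          field_simp
        have e2 : w z t (n+1) = - w z t n * z * (t^2)^n := by
          rw [w, w, zpow_add_one₀ (neg_ne_zero.2 hz), show (n+1)*(n+1-1) = n*(n-1) + 2 * n by ring,
            zpow_add₀ ht, zpow_mul t 2 n]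
          norm_cast
          ring
        rw [e1, e2]
        generalize w z t n = W
        have r := iq_rec (norm_sq_lt h1)
        simp only [cN]
        have r1 := r (N+1-n)
        have r2 := r (N+1+n)
        have r3 := r (N+n)
        have r4 := r (N-n)
        rw [show (N:ℤ)+1-n-1 = N-n by ring] at r1
        rw [show (N:ℤ)+1+n-1 = N+n by ring] at r2
        rw [show (N:ℤ)-(n-1) = N+1-n by ring, show (N:ℤ)+(n-1) = N+n-1 by ring, show (N:ℤ)-(n+1) = N-n-1 by ring, show (N:ℤ)+(n+1) = N+1+n by ring, r3, r4, r1, r2]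
        have p1 : (t^2)^((N:ℤ)+1-n) = (t^2)^N * t^2 / (t^2)^n := by
          rw [zpow_sub₀ hq, zpow_add_one₀ hq, zpow_natCast]
        have p2 : (t^2)^((N:ℤ)+1+n) = (t^2)^N * t^2 * (t^2)^n := by
          rw [zpow_add₀ hq, zpow_add_one₀ hq, zpow_natCast]
        have p3 : (t^2)^((N:ℤ)-n) = (t^2)^N / (t^2)^n := by
          rw [zpow_sub₀ hq, zpow_natCast]
        have p4 : (t^2)^((N:ℤ)+n) = (t^2)^N * (t^2)^n := by
          rw [zpow_add₀ hq, zpow_natCast]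
        rw [p1, p2, p3, p4, show (t^2)^(2*N+1) = (t^2)^N * (t^2)^N * t^2 by ring,
          show (t^2)^(2*N+2) = (t^2)^N * (t^2)^N * t^2 * t^2 by ring, show (t^2)^(N+1) = (t^2)^N * t^2 by ring]
        generalize (t^2)^N = Q
        generalize (t^2)^n = x at *
        generalize t^2 = q at *
        field_simp
        ring
      · field_simp
        ring
    have e : 2 * (N+1) = 2*N+1+1 := by ring
    rw [e, qf_succ, qf_succ, qf_succ, qf_succ]
    push_cast
    linear_combination (qf (t^2) (t^2) (2*N)) * key + ((1 - z * (t^2)^N)*(1 - t^2/z*(t^2)^N)) * ih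

/-- Jacobi triple product -/
theorem jtp {z t : ℂ} (ht : t ≠ 0) (h1 : ‖t‖ < 1) (hz : z ≠ 0) :
    HasSum (w z t) (qp z (t^2) * qp (t^2/z) (t^2) * qp (t^2) (t^2)) := by
  have hq := norm_sq_lt h1
  obtain ⟨M, h0, hM⟩ := cN_bound hq
  have hs := w_norm ht h1 hz
  have l1 : Tendsto (fun N : ℕ => ∑' n : ℤ, w z t n * cN (t^2) N n) atTop
      (𝓝 (∑' n : ℤ, w z t n * ((qp (t^2) (t^2))⁻¹ * (qp (t^2) (t^2))⁻¹))) := by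
    refine tendsto_tsum_of_dominated_convergence (hs.mul_left M) ?_ ?_
    · intro n; exact (cN_tendsto hq n).const_mul _
    · refine Eventually.of_forall fun N n => ?_
      rw [norm_mul, mul_comm]
      exact mul_le_mul_of_nonneg_right (hM _ _) (norm_nonneg _)
  have l2 := l1.mul ((qf_tendsto (t^2) hq).comp (tendsto_id.const_mul_atTop' (show 0 < 2 by norm_num) : Tendsto (fun N : ℕ => 2 * N) atTop atTop))
  have l3 := (qf_tendsto z hq).mul (qf_tendsto (t^2/z) hq)
  have e := tendsto_nhds_unique l2 (l3.congr fun N => (jtp_fin ht h1 hz N).symm)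
  have hne := qpq_ne hq
  rw [tsum_mul_right] at e
  have : ∑' n, w z t n = qp z (t^2) * qp (t^2/z) (t^2) * qp (t^2) (t^2) := by
    rw [← e]; field_simp
  rw [← this]
  exact hs.of_norm.hasSum

theorem w_q (t : ℂ) (ht : t ≠ 0) (n : ℤ) : w (t^2) t n = (-1)^n * t^(n*(n+1)) := by
  rw [w, neg_eq_neg_one_mul, mul_zpow, mul_assoc, ← zpow_natCast t 2, ← zpow_mul, ← zpow_add₀ ht]
  congr 2; push_cast; ring

theorem w_one (t : ℂ) (n : ℤ) : w 1 t n = (-1)^n * t^(n*(n-1)) := rfl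

/-- Appell type sum term -/
noncomputable def aT (z t : ℂ) (n : ℤ) : ℂ := (-1)^n * t^(n*(n+1)) / (1 - z * (t^2)^n)

theorem aT_norm {z t : ℂ} (ht : t ≠ 0) (h1 : ‖t‖ < 1)
    (hz : ∃ c : ℝ, 0 < c ∧ ∀ n : ℤ, c ≤ ‖1 - z * (t^2)^n‖) :
    Summable fun n : ℤ => ‖aT z t n‖ := by
  obtain ⟨c, hc, h⟩ := hz
  refine Summable.of_nonneg_of_le (fun _ => norm_nonneg _) (fun n => ?_) ((w_norm ht h1 (pow_ne_zero 2 ht)).mul_right c⁻¹)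
  rw [aT, ← w_q t ht, norm_div, div_eq_mul_inv]
  exact mul_le_mul_of_nonneg_left (inv_anti₀ hc (h n)) (norm_nonneg _)

theorem f1_fin {z t : ℂ} (ht : t ≠ 0) (h1 : ‖t‖ < 1) (hz0 : z ≠ 0)
    (hz : ∃ c : ℝ, 0 < c ∧ ∀ n : ℤ, c ≤ ‖1 - z * (t^2)^n‖) (N : ℕ) :
    (∑' n : ℤ, aT z t n * cN (t^2) N n) * (qf z (t^2) (N+1) * qf (t^2/z) (t^2) N) = 1 := by
  have hq := norm_sq_lt h1
  have hq0 : t^2 ≠ 0 := pow_ne_zero _ ht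
  obtain ⟨M, h0, hM⟩ := cN_bound hq
  have hsum : ∀ N : ℤ, Summable fun n : ℤ => aT z t n * cN (t^2) N n := fun N => by
    refine Summable.of_norm_bounded ((aT_norm ht h1 hz).mul_left M) fun n => ?_
    rw [norm_mul, mul_comm]
    exact mul_le_mul_of_nonneg_right (hM _ _) (norm_nonneg _)
  have hne : ∀ n : ℤ, 1 - z * (t^2)^n ≠ 0 := fun n => by
    obtain ⟨c, hc, h⟩ := hz
    exact norm_pos_iff.1 (hc.trans_le (h n))
  induction N with
  | zero =>
    rw [tsum_eq_single 0]
    · have := hne 0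
      simp [aT, cN_00, qf_zero, qf_succ] at this ⊢
      exact inv_mul_cancel₀ this
    · intro n hn; simp [cN_zero n hn]
  | succ N ih =>
    have v1 : ∑' n : ℤ, w 1 t n * cN (t^2) (N+1) n = 0 := by
      have := jtp_fin ht h1 one_ne_zero (N+1)
      have z0 : qf 1 (t^2) (N+1) = 0 := by
        apply Finset.prod_eq_zero (i := 0) <;> simp
      rw [z0, zero_mul] at this
      simpa [qfq_ne hq] using this
    have v2 : ∑' n : ℤ, w (t^2) t n * cN (t^2) (N+1) n = 0 := by
      have := jtp_fin ht h1 hq0 (N+1)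
      have z0 : qf (t^2/t^2) (t^2) (N+1) = 0 := by
        apply Finset.prod_eq_zero (i := 0) <;> simp [ht]
      rw [z0, mul_zero] at this
      simpa [qfq_ne hq] using this
    have s0 := (hsum N).hasSum
    have s1 := (wc_summable ht h1 one_ne_zero (N+1)).hasSum.mul_left ((t^2)^(N+1))
    have s2 := (wc_summable ht h1 hq0 (N+1)).hasSum.mul_left ((t^2)^(N+1)/z)
    have s3 := (hsum (N+1)).hasSum.mul_left ((1 - z * (t^2)^(N+1))*(1 - t^2/z*(t^2)^N))
    have s4 := (s0.add s1).sub s2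
    rw [v1, v2, mul_zero, mul_zero, add_zero, sub_zero] at s4
    have key := s3.unique (by
      refine s4.cg (fun n => ?_) rfl
      have hx : (t^2)^n ≠ 0 := zpow_ne_zero _ hq0
      have r1 := iq_rec hq (N+1-n)
      have r2 := iq_rec hq (N+1+n)
      rw [show (N:ℤ)+1-n-1 = N-n by ring] at r1
      rw [show (N:ℤ)+1+n-1 = N+n by ring] at r2
      have e1 : w 1 t n = w (t^2) t n / (t^2)^n := by
        rw [w_q t ht, w_one, show n*(n-1) = n*(n+1) - 2*n by ring, zpow_sub₀ ht, zpow_mul t 2 n]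
        norm_cast
        rw [mul_div_assoc]
      rw [aT, ← w_q t ht, e1]
      have := hne n
      simp only [cN]
      rw [r1, r2]
      have p1 : (t^2)^((N:ℤ)+1-n) = (t^2)^N * t^2 / (t^2)^n := by
        rw [zpow_sub₀ hq0, zpow_add_one₀ hq0, zpow_natCast]
      have p2 : (t^2)^((N:ℤ)+1+n) = (t^2)^N * t^2 * (t^2)^n := by
        rw [zpow_add₀ hq0, zpow_add_one₀ hq0, zpow_natCast]
      rw [p1, p2, pow_succ (t^2) N]
      generalize w (t^2) t n = W
      generalize (t^2)^N = Q
      generalize (t^2)^n = x at *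
      generalize t^2 = q at *
      field_simp
      ring)
    rw [qf_succ z, qf_succ (t^2/z)]
    push_cast
    linear_combination (qf z (t^2) (N+1) * qf (t^2/z) (t^2) N) * key + ih

theorem f1 {z t : ℂ} (ht : t ≠ 0) (h1 : ‖t‖ < 1) (hz0 : z ≠ 0)
    (hz : ∃ c : ℝ, 0 < c ∧ ∀ n : ℤ, c ≤ ‖1 - z * (t^2)^n‖) :
    (∑' n : ℤ, aT z t n) * (qp z (t^2) * qp (t^2/z) (t^2)) = qp (t^2) (t^2) ^ 2 := by
  have hq := norm_sq_lt h1
  obtain ⟨M, h0, hM⟩ := cN_bound hq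
  have hs := aT_norm ht h1 hz
  have l1 : Tendsto (fun N : ℕ => ∑' n : ℤ, aT z t n * cN (t^2) N n) atTop
      (𝓝 (∑' n : ℤ, aT z t n * ((qp (t^2) (t^2))⁻¹ * (qp (t^2) (t^2))⁻¹))) := by
    refine tendsto_tsum_of_dominated_convergence (hs.mul_left M) ?_ ?_
    · intro n; exact (cN_tendsto hq n).const_mul _
    · refine Eventually.of_forall fun N n => ?_
      rw [norm_mul, mul_comm]
      exact mul_le_mul_of_nonneg_right (hM _ _) (norm_nonneg _)
  have l2 := l1.mul (((qf_tendsto z hq).comp (tendsto_add_atTop_nat 1)).mul (qf_tendsto (t^2/z) hq))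
  have e := tendsto_nhds_unique l2 (tendsto_const_nhds.congr fun N => (f1_fin ht h1 hz0 hz N).symm)
  have hne := qpq_ne hq
  rw [tsum_mul_right] at e
  field_simp at e
  linear_combination e

theorem tsum_anti {f : ℤ → ℂ} (c : ℤ) (h : ∀ k, f (c - k) = - f k) : ∑' k, f k = 0 := by
  have h1 := (Equiv.subLeft c).tsum_eq f
  simp only [Equiv.subLeft_apply, h, tsum_neg] at h1
  linear_combination -(1/2) * h1

theorem int_rec {f : ℤ → ℂ} {c : ℂ} (hc : c ≠ 0) (h : ∀ j, f (j+1) = c * f j) (n : ℤ) : f n = c ^ n * f 0 := by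
  induction n using Int.induction_on with
  | zero => simp
  | succ i ih => rw [h, ih, zpow_add_one₀ hc]; ring
  | pred i ih =>
    have := h (-i-1)
    rw [sub_add_cancel, ih] at this
    rw [zpow_sub_one₀ hc, mul_right_comm, this]; field_simp

theorem neg_one_zpow_sq (n : ℤ) : ((-1:ℂ))^n * (-1)^n = 1 := by
  rw [← mul_zpow]; simp

theorem neg_one_zpow_neg (n : ℤ) : ((-1:ℂ))^(-n) = (-1)^n := by
  rw [zpow_neg]
  exact (inv_eq_of_mul_eq_one_left (neg_one_zpow_sq n))

theorem neg_one_zpow_two (n : ℤ) : ((-1:ℂ))^(2*n) = 1 := by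
  rw [zpow_mul]; simp

theorem sqz (t : ℂ) (n : ℤ) : (t^2)^n = t^(2*n) := by
  rw [zpow_mul]; norm_cast

/-- u n = (-1)^n q^(n(n+1)/2) -/
noncomputable def uT (t : ℂ) (n : ℤ) : ℂ := (-1)^n * t^(n*(n+1))

theorem uT_norm {t : ℂ} (ht : t ≠ 0) (h1 : ‖t‖ < 1) (j : ℤ) :
    Summable fun n : ℤ => ‖uT t n * t^(2*j*n)‖ := by
  refine (w_norm ht h1 (z := t^(2*j+2)) (zpow_ne_zero _ ht)).congr fun n => ?_
  rw [w, uT, neg_eq_neg_one_mul, mul_zpow, mul_assoc, mul_assoc, ← zpow_mul, ← zpow_add₀ ht, ← zpow_add₀ ht]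
  congr 3; ring

theorem theta_van {t : ℂ} (ht : t ≠ 0) (j : ℤ) : ∑' n : ℤ, uT t n * t^(2*j*n) = 0 := by
  apply tsum_anti (-1-2*j)
  intro k
  have e : ((-1:ℂ))^(-1-2*j-k) = -(-1)^k := by
    rw [show -1-2*j-k = -1 + 2*(-j) + (-k) by ring, zpow_add₀ (by norm_num), zpow_add₀ (by norm_num),
      neg_one_zpow_two, neg_one_zpow_neg k]; simp
  rw [uT, uT, e, mul_assoc, mul_assoc ((-1:ℂ)^k), ← zpow_add₀ ht, ← zpow_add₀ ht, neg_mul]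
  congr 3; ring

/-- general bound hypotheses -/
structure Bd (t z : ℂ) (c : ℝ) : Prop where
  t0 : t ≠ 0
  t1 : ‖t‖ < 1
  z0 : z ≠ 0
  c0 : 0 < c
  b1 : ∀ n : ℤ, c ≤ ‖1 - z * t^(2*n)‖
  b2 : ∀ n : ℤ, c ≤ ‖1 + z^2 * t^(2*n)‖
  b3 : ∀ n : ℤ, c ≤ ‖1 + t^(2*n)‖

theorem inv_norm_le {x : ℂ} {c : ℝ} (hc : 0 < c) (h : c ≤ ‖x‖) : ‖x⁻¹‖ ≤ c⁻¹ := by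
  rw [norm_inv]; exact inv_anti₀ hc h

theorem summable_bdd {ι : Type*} {f g : ι → ℂ} (C : ℝ) (hf : Summable fun n => ‖f n‖) (hg : ∀ n, ‖g n‖ ≤ C) :
    Summable fun n => ‖f n * g n‖ := by
  refine Summable.of_nonneg_of_le (fun _ => norm_nonneg _) (fun n => ?_) (hf.mul_right C)
  rw [norm_mul]; exact mul_le_mul_of_nonneg_left (hg n) (norm_nonneg _)

theorem Bd.n1 {t z : ℂ} {c : ℝ} (H : Bd t z c) (n : ℤ) : 1 - z * t^(2*n) ≠ 0 := norm_pos_iff.1 (H.c0.trans_le (H.b1 n))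
theorem Bd.n2 {t z : ℂ} {c : ℝ} (H : Bd t z c) (n : ℤ) : 1 + z^2 * t^(2*n) ≠ 0 := norm_pos_iff.1 (H.c0.trans_le (H.b2 n))
theorem Bd.n3 {t z : ℂ} {c : ℝ} (H : Bd t z c) (n : ℤ) : 1 + t^(2*n) ≠ 0 := norm_pos_iff.1 (H.c0.trans_le (H.b3 n))

theorem tsum_even_odd {f : ℤ → ℂ} (hf : Summable f) : ∑' m, f m = ∑' s, (f (2*s) + f (2*s+1)) := by
  have h := (Int.divModEquiv 2).symm.tsum_eq f
  have hs : Summable fun p : ℤ × Fin 2 => f ((Int.divModEquiv 2).symm p) := 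
    ((Int.divModEquiv 2).symm.summable_iff).2 hf
  rw [← h, hs.tsum_prod]
  congr 1; ext s
  rw [tsum_fintype, Fin.sum_univ_two]
  simp [Int.divModEquiv, mul_comm]

/-- B(1) -/
noncomputable def B1 (t : ℂ) : ℂ := ∑' l : ℤ, uT (t^2) l / (1 + t^(4*l+2))

theorem uT_sq {t : ℂ} (l : ℤ) : uT (t^2) l = (-1)^l * t^(2*(l*(l+1))) := by
  rw [uT, sqz]

theorem part1 {t z : ℂ} {c : ℝ} (H : Bd t z c) (n : ℤ) :
    ∑' m : ℤ, uT (t^2) m / (1 + t^(2*(2*m+1-2*n))) = t^(2*n^2) * B1 t := by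
  have ht := H.t0
  rw [← (Equiv.addLeft n).tsum_eq]
  simp only [Equiv.coe_addLeft]
  have ht2 : t^2 ≠ 0 := pow_ne_zero _ ht
  let T : ℤ → ℂ := fun j => ∑' l : ℤ, uT (t^2) l * t^(4*j*l) / (1 + t^(4*l+2))
  have hsum : ∀ j : ℤ, Summable fun l : ℤ => uT (t^2) l * t^(4*j*l) := fun j => by
    refine (uT_norm ht2 (norm_sq_lt H.t1) j).of_norm.congr fun l => ?_
    rw [sqz]; congr 2; ring
  have hsum' : ∀ j : ℤ, Summable fun l : ℤ => uT (t^2) l * t^(4*j*l) / (1 + t^(4*l+2)) := fun j => by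
    refine (summable_bdd (c⁻¹) (hsum j).norm fun l => ?_).of_norm
    apply inv_norm_le H.c0
    rw [show 4*l+2 = 2*(2*l+1) by ring]; exact H.b3 _
  have hrec : ∀ j, T (j+1) = -(t^2)⁻¹ * T j := by
    intro j
    have h0 := theta_van ht2 j
    have e : ∀ l : ℤ, t^2 * (uT (t^2) l * t^(4*(j+1)*l) / (1 + t^(4*l+2))) + uT (t^2) l * t^(4*j*l) / (1 + t^(4*l+2))
       = uT (t^2) l * (t^2)^(2*j*l) := by
      intro l
      have := H.n3 (2*l+1)
      rw [show 2*(2*l+1) = 4*l+2 by ring] at this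
      rw [sqz, show 4*(j+1)*l = 4*j*l + 4*l by ring, zpow_add₀ ht, show 2*(2*j*l) = 4*j*l by ring]
      rw [zpow_add₀ ht] at *
      rw [show t^(2:ℤ) = t^2 from by norm_cast] at *
      generalize t^(4*l) = X at *
      have h' : 1 + t^2 * X ≠ 0 := by rwa [mul_comm]
      field_simp
      ring
    have := ((hsum' (j+1)).hasSum.mul_left (t^2)).add (hsum' j).hasSum
    have h2 := (this.cg (fun l => (e l).symm) rfl).tsum_eq
    rw [h0] at h2
    simp only [T]
    field_simp
    linear_combination -h2
  have hT := int_rec (neg_ne_zero.2 (inv_ne_zero ht2)) hrec n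
  have e : ∀ l : ℤ, uT (t^2) (n+l) / (1 + t^(2*(2*(n+l)+1-2*n))) =
     ((-1)^n * t^(2*n^2+2*n)) * (uT (t^2) l * t^(4*n*l) / (1 + t^(4*l+2))) := by
    intro l
    rw [show 2*(2*(n+l)+1-2*n) = 4*l+2 by ring, ← mul_div_assoc]
    congr 1
    rw [uT_sq, uT_sq, zpow_add₀ (by norm_num),
     show 2*((n+l)*(n+l+1)) = (2*n^2+2*n) + 2*(l*(l+1)) + 4*n*l by ring]
    simp only [zpow_add₀ ht]; ring
  rw [tsum_congr e, tsum_mul_left]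
  change _ * T n = _
  rw [hT]
  have : T 0 = B1 t := by simp [T, B1]
  have hneg : (-(t^2)⁻¹)^n = (-1)^n * (t^(2*n))⁻¹ := by
    rw [neg_eq_neg_one_mul, mul_zpow, inv_zpow, sqz]
  rw [this, zpow_add₀ ht, hneg]
  have hh := neg_one_zpow_sq n
  have h2 : t^(2*n) ≠ 0 := zpow_ne_zero _ ht
  field_simp
  linear_combination B1 t * hh

/-- sigma_m -/
noncomputable def sg (t : ℂ) (m : ℤ) : ℂ := ∑' k : ℤ, uT t k * t^(2*m*k) / (t^(4*k) + t^2)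

theorem sg_summ {t z : ℂ} {c : ℝ} (H : Bd t z c) (m : ℤ) : Summable fun k : ℤ => uT t k * t^(2*m*k) / (t^(4*k) + t^2) := by
  have ht := H.t0
  have h := summable_bdd (c⁻¹) (uT_norm ht H.t1 (m-2)) (g := fun k => (1 + t^(2*(1-2*k)))⁻¹) (fun k => inv_norm_le H.c0 (H.b3 _))
  refine h.of_norm.congr fun k => ?_
  have e : t^(4*k) + t^2 = t^(4*k) * (1 + t^(2*(1-2*k))) := by
    rw [mul_add, ← zpow_add₀ ht, show 4*k+2*(1-2*k) = (2:ℕ) by push_cast; ring, zpow_natCast, mul_one]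
  rw [e, show 2*m*k = 2*(m-2)*k + 4*k by ring, zpow_add₀ ht]
  have := H.n3 (1-2*k)
  have h2 : t^(4*k) ≠ 0 := zpow_ne_zero _ ht
  field_simp

theorem sg_den {t z : ℂ} {c : ℝ} (H : Bd t z c) (k : ℤ) : t^(4*k) + t^2 ≠ 0 := by
  have ht := H.t0
  have e : t^(4*k) + t^2 = t^(4*k) * (1 + t^(2*(1-2*k))) := by
    rw [mul_add, ← zpow_add₀ ht, show 4*k+2*(1-2*k) = (2:ℕ) by push_cast; ring, zpow_natCast, mul_one]
  rw [e]
  exact mul_ne_zero (zpow_ne_zero _ ht) (H.n3 _)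

theorem sg_rec {t z : ℂ} {c : ℝ} (H : Bd t z c) (m : ℤ) : sg t (m+2) = -t^2 * sg t m := by
  have ht := H.t0
  have h := (sg_summ H (m+2)).hasSum.add ((sg_summ H m).hasSum.mul_left (t^2))
  have h0 := theta_van ht m
  have e := (h.cg (g := fun n => uT t n * t^(2*m*n)) (fun k => by
    have := sg_den H k
    rw [show 2*(m+2)*k = 2*m*k + 4*k by ring, zpow_add₀ ht]
    field_simp
    ) rfl).tsum_eq
  rw [h0] at e
  simp only [sg]
  linear_combination -e

theorem sg_zero {t z : ℂ} {c : ℝ} (H : Bd t z c) : sg t 0 = 0 := by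
  have ht := H.t0
  apply tsum_anti 1
  intro k
  have h1 := sg_den H k
  have h2 := sg_den H (1-k)
  have e : ((-1:ℂ))^(1-k) = -(-1)^k := by
    rw [sub_eq_add_neg, zpow_add₀ (by norm_num), neg_one_zpow_neg]; simp
  rw [div_eq_iff h2, mul_comm (-_), ← neg_div, ← mul_div_assoc, eq_div_iff h1, uT, uT, e]
  simp only [mul_zero, zero_mul, zpow_zero, mul_one]
  rw [show (1-k)*(1-k+1) = k*(k+1) + 2 - 4*k by ring, zpow_sub₀ ht, show 4*(1-k) = 4-4*k by ring, zpow_sub₀ ht,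
   zpow_add₀ ht]
  have h2 : t^(4*k) ≠ 0 := zpow_ne_zero _ ht
  norm_cast
  field_simp
  ring

theorem sg_even {t z : ℂ} {c : ℝ} (H : Bd t z c) (s : ℤ) : sg t (2*s) = 0 := by
  have := int_rec (f := fun s => sg t (2*s)) (neg_ne_zero.2 (pow_ne_zero 2 H.t0)) (fun j => by
    simpa [mul_add] using sg_rec H (2*j)) s
  simpa [sg_zero H] using this

theorem sg_odd {t z : ℂ} {c : ℝ} (H : Bd t z c) (s : ℤ) : sg t (2*s+1) = (-1)^s * t^(2*s) * sg t 1 := by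
  have := int_rec (f := fun s => sg t (2*s+1)) (neg_ne_zero.2 (pow_ne_zero 2 H.t0)) (fun j => by
    have := sg_rec H (2*j+1)
    rwa [show 2*j+1+2 = 2*(j+1)+1 by ring] at this) s
  rw [neg_eq_neg_one_mul, mul_zpow, sqz] at this
  simpa using this

/-- second inner sum -/
theorem part2 {t z : ℂ} {c : ℝ} (H : Bd t z c) (m : ℤ) :
    ∑' n : ℤ, uT t n * (1 + z * t^(2*n)) * (1 + t^(2*(2*n-2*m-1)))⁻¹ =
      (-1)^m * t^(m*(m+1)+2) * (sg t m + z * t^(2*m) * sg t (m+1)) := by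
  have ht := H.t0
  rw [← (Equiv.addLeft m).tsum_eq]
  simp only [Equiv.coe_addLeft]
  have h := (((sg_summ H m).hasSum).add ((sg_summ H (m+1)).hasSum.mul_left (z * t^(2*m)))).mul_left ((-1)^m * t^(m*(m+1)+2))
  refine (h.cg (fun k => ?_) rfl).tsum_eq
  have h1 := sg_den H k
  have h2 := H.n3 (2*k-1)
  rw [show 2*(2*(m+k)-2*m-1) = 2*(2*k-1) by ring]
  have e : t^(4*k) + t^2 = t^2 * (1 + t^(2*(2*k-1))) := by
    rw [show 2*(2*k-1) = 4*k - 2 by ring, zpow_sub₀ ht]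
    norm_cast
    field_simp
    ring
  rw [e, uT, uT, zpow_add₀ (by norm_num : (-1:ℂ) ≠ 0), show (m+k)*(m+k+1) = m*(m+1) + (k*(k+1)) + 2*m*k by ring,
    show 2*(m+1)*k = 2*m*k + 2*k by ring, show 2*(m+k) = 2*m+2*k by ring]
  simp only [zpow_add₀ ht]
  norm_cast
  field_simp

/-- K term -/
noncomputable def kT (t z : ℂ) (n : ℤ) : ℂ := (-1)^n * t^(n*(3*n+1)) / (1 - z * t^(2*n))

/-- numerator of Psi -/
noncomputable def pN (t : ℂ) (s : ℤ) : ℂ := (-1)^s * t^(12*s^2+12*s+2)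

set_option maxHeartbeats 1000000 in
/-- The fundamental product identity. -/
theorem star {t z : ℂ} {c : ℝ} (H : Bd t z c) :
    (∑' n : ℤ, aT z t n) * (∑' m : ℤ, aT (-(z^2*t^2)) (t^2) m) =
     B1 t * (∑' n : ℤ, kT t z n) +
     sg t 1 * (∑' s : ℤ, (z * (pN t s / (1 + z^2 * t^(8*s+2))) - pN t s / (z^2 + t^(8*s+2)))) := by
  have ht := H.t0
  have ht2 : t^2 ≠ 0 := pow_ne_zero _ ht
  have hb := inv_pos.2 H.c0
  let X : ℤ × ℤ → ℂ := fun p => uT t p.1 * uT (t^2) p.2 * ((1 - z * t^(2*p.1))⁻¹ * (1 + t^(2*(2*p.2+1-2*p.1)))⁻¹)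
  let Y : ℤ × ℤ → ℂ := fun p => (uT t p.1 * (1 + z * t^(2*p.1))) * uT (t^2) p.2 * ((1 + t^(2*(2*p.1-2*p.2-1)))⁻¹ * (1 + z^2 * t^(2*(2*p.2+1)))⁻¹)
  have su : Summable fun n : ℤ => ‖uT t n‖ := by simpa using uT_norm ht H.t1 0
  have su' : Summable fun n : ℤ => ‖uT t n * (1 + z * t^(2*n))‖ := by
    have h := su.add ((uT_norm ht H.t1 1).mul_left ‖z‖)
    refine Summable.of_nonneg_of_le (fun _ => norm_nonneg _) (fun n => ?_) h
    rw [← norm_mul, show uT t n * (1 + z * t^(2*n)) = uT t n + z * (uT t n * t^(2*1*n)) by ring_nf]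
    exact norm_add_le _ _
  have sv : Summable fun n : ℤ => ‖uT (t^2) n‖ := by simpa using uT_norm ht2 (norm_sq_lt H.t1) 0
  have sX : Summable X := by
    have h : Summable fun p : ℤ × ℤ => ‖uT t p.1 * uT (t^2) p.2‖ := su.mul_norm sv
    refine (summable_bdd (c⁻¹ * c⁻¹) h fun p => ?_).of_norm
    rw [norm_mul]
    exact mul_le_mul (inv_norm_le H.c0 (H.b1 _)) (inv_norm_le H.c0 (H.b3 _)) (norm_nonneg _) hb.le
  have sY : Summable Y := by
    have h : Summable fun p : ℤ × ℤ => ‖uT t p.1 * (1 + z * t^(2*p.1)) * uT (t^2) p.2‖ := su'.mul_norm sv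
    refine (summable_bdd (c⁻¹ * c⁻¹) h fun p => ?_).of_norm
    rw [norm_mul]
    exact mul_le_mul (inv_norm_le H.c0 (H.b3 _)) (inv_norm_le H.c0 (H.b2 _)) (norm_nonneg _) hb.le
  have ea : ∀ n, aT z t n = uT t n * (1 - z * t^(2*n))⁻¹ := fun n => by rw [aT, uT, sqz, div_eq_mul_inv]
  have eb : ∀ m, aT (-(z^2*t^2)) (t^2) m = uT (t^2) m * (1 + z^2 * t^(2*(2*m+1)))⁻¹ := fun m => by
    rw [aT, uT, sqz, sqz, div_eq_mul_inv, sqz, show 2*(2*m+1) = 2*(2*m) + 2 by ring, zpow_add₀ ht]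
    norm_cast
    congr 2; ring
  have sA : Summable fun n => ‖aT z t n‖ := by
    simp only [ea]; exact summable_bdd c⁻¹ su fun n => inv_norm_le H.c0 (H.b1 _)
  have sB : Summable fun n => ‖aT (-(z^2*t^2)) (t^2) n‖ := by
    simp only [eb]; exact summable_bdd c⁻¹ sv fun n => inv_norm_le H.c0 (H.b2 _)
  have e1 : (∑' n : ℤ, aT z t n) * (∑' m : ℤ, aT (-(z^2*t^2)) (t^2) m) = ∑' p, X p + ∑' p, Y p := by
    rw [tsum_mul_tsum_of_summable_norm sA sB, ← sX.tsum_add sY]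
    refine tsum_congr fun p => ?_
    obtain ⟨n, m⟩ := p
    simp only [ea, eb, X, Y]
    have h1 := H.n1 n
    have h2 := H.n2 (2*m+1)
    have h3 := H.n3 (2*m+1-2*n)
    have h4 := H.n3 (2*n-2*m-1)
    have ee : t^(2*(2*m+1-2*n)) = t^(2*(2*m+1)) / (t^(2*n))^2 := by
      rw [show 2*(2*m+1-2*n) = 2*(2*m+1) - (2*n + 2*n) by ring, zpow_sub₀ ht, zpow_add₀ ht, sq]
    have ee' : t^(2*(2*n-2*m-1)) = (t^(2*n))^2 / t^(2*(2*m+1)) := by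
      rw [show 2*(2*n-2*m-1) = (2*n + 2*n) - 2*(2*m+1) by ring, zpow_sub₀ ht, zpow_add₀ ht, sq]
    have ha : t^(2*n) ≠ 0 := zpow_ne_zero _ ht
    have hb : t^(2*(2*m+1)) ≠ 0 := zpow_ne_zero _ ht
    rw [ee] at h3
    rw [ee'] at h4
    rw [ee, ee']
    generalize t^(2*n) = a at *
    generalize t^(2*(2*m+1)) = b at *
    have h5 : a^2 + b ≠ 0 := by
      intro h; apply h3; field_simp; rw [mul_zero]; exact h
    have h6 : 1 + b/a^2 = (a^2+b)/a^2 := by field_simp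
    have h7 : 1 + a^2/b = (a^2+b)/b := by field_simp; ring
    rw [h6, h7]
    field_simp
    ring
  have e2 : ∑' p, X p = B1 t * (∑' n : ℤ, kT t z n) := by
    rw [sX.tsum_prod, ← tsum_mul_left]
    refine tsum_congr fun n => ?_
    have := part1 H n
    simp only [X]
    rw [kT, show n*(3*n+1) = n*(n+1) + 2*n^2 by ring, zpow_add₀ ht]
    have e : ∀ m, uT t n * uT (t^2) m * ((1 - z * t^(2*n))⁻¹ * (1 + t^(2*(2*m+1-2*n)))⁻¹) =
       (uT t n * (1 - z * t^(2*n))⁻¹) * (uT (t^2) m / (1 + t^(2*(2*m+1-2*n)))) := fun m => by ring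
    rw [tsum_congr e, tsum_mul_left, this, uT]
    ring
  have inner : ∀ m : ℤ, ∑' n, Y (n, m) = uT (t^2) m * (1 + z^2 * t^(2*(2*m+1)))⁻¹ *
      ((-1)^m * t^(m*(m+1)+2) * (sg t m + z * t^(2*m) * sg t (m+1))) := by
    intro m
    rw [← part2 H m, ← tsum_mul_left]
    congr 1
    ext n
    simp only [Y]
    ring
  have sY2 : Summable fun p : ℤ × ℤ => Y p.swap := sY.prod_symm
  have tY2 : ∑' p : ℤ × ℤ, Y p.swap = ∑' p, Y p := (Equiv.prodComm ℤ ℤ).tsum_eq Y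
  clear_value Y X
  have e3 : ∑' p, Y p = ∑' m : ℤ, uT (t^2) m * (1 + z^2 * t^(2*(2*m+1)))⁻¹ *
      ((-1)^m * t^(m*(m+1)+2) * (sg t m + z * t^(2*m) * sg t (m+1))) := by
    rw [← tY2, sY2.tsum_prod]
    simp only [Prod.swap_prod_mk, inner]
  have s3 : Summable fun m : ℤ => uT (t^2) m * (1 + z^2 * t^(2*(2*m+1)))⁻¹ *
      ((-1)^m * t^(m*(m+1)+2) * (sg t m + z * t^(2*m) * sg t (m+1))) := by
    have h := sY2.prod
    simpa only [Prod.swap_prod_mk, inner] using h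
  rw [e1, e2, e3]
  congr 1
  rw [tsum_even_odd s3]
  generalize hF : (fun m : ℤ => uT (t^2) m * (1 + z^2 * t^(2*(2*m+1)))⁻¹ *
      ((-1)^m * t^(m*(m+1)+2) * (sg t m + z * t^(2*m) * sg t (m+1)))) = F at s3
  have hF' := fun m => congrFun hF m
  simp only [hF']
  have i1 : Function.Injective fun s : ℤ => 2*s := fun a b h => by simp only at h; omega
  have i2 : Function.Injective fun s : ℤ => 2*s+1 := fun a b h => by simp only at h; omega
  have j1 : Summable fun s : ℤ => F (2*s) := s3.comp_injective i1
  have j2 : Summable fun s : ℤ => F (2*s+1) := s3.comp_injective i2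
  have j3 : Summable fun s : ℤ => F (2*(-1-s)+1) := by
    have h := (Equiv.subLeft (-1:ℤ)).summable_iff.2 j2
    simpa only [Function.comp_def, Equiv.subLeft_apply] using h
  rw [j1.tsum_add j2, ← (Equiv.subLeft (-1:ℤ)).tsum_eq (fun s => F (2*s+1))]
  simp only [Equiv.subLeft_apply]
  rw [← j1.tsum_add j3, ← tsum_mul_left]
  refine tsum_congr fun s => ?_
  have e0 : sg t (2*(-1-s)+1+1) = 0 := by
    rw [show 2*(-1-s)+1+1 = 2*(-s) by ring]; exact sg_even H _
  rw [← hF', ← hF', sg_even H, sg_odd H, sg_odd H, e0]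
  have h1 := H.n2 (4*s+1)
  rw [show 2*(4*s+1) = 8*s+2 by ring] at h1
  have h2 := H.n2 (-(4*s+1))
  have h3 : z^2 + t^(8*s+2) = t^(8*s+2) * (1 + z^2 * t^(2*(-(4*s+1)))) := by
    rw [mul_add, mul_one, mul_left_comm, ← zpow_add₀ ht, show 8*s+2+2*(-(4*s+1)) = 0 by ring, zpow_zero]; ring
  have h0 : t^(8*s+2) ≠ 0 := zpow_ne_zero _ ht
  rw [h3, show 2*(2*(2*s)+1) = 8*s+2 by ring, show 2*(2*(2*(-1-s)+1)+1) = 2*(-(4*s+1)) by ring]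
  have k1 : uT (t^2) (2*s) * ((-1)^(2*s) * t^(2*s*(2*s+1)+2) * (z * t^(2*(2*s)) * ((-1)^s * t^(2*s)))) = z * pN t s := by
    rw [uT, sqz, pN, neg_one_zpow_two, show 12*s^2+12*s+2 = 2*(2*s*(2*s+1)) + (2*s*(2*s+1)+2) + (2*(2*s)) + 2*s by ring]
    simp only [zpow_add₀ ht]
    ring
  have k2 : uT (t^2) (2*(-1-s)+1) * ((-1)^(2*(-1-s)+1) * t^((2*(-1-s)+1)*(2*(-1-s)+1+1)+2) * ((-1)^(-1-s) * t^(2*(-1-s)))) = -(pN t s / t^(8*s+2)) := by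
    have g1 : ((-1:ℂ))^(2*(-1-s)+1) = -1 := by
      rw [zpow_add₀ (by norm_num), neg_one_zpow_two]; norm_num
    have g2 : ((-1:ℂ))^(-1-s) = -(-1)^s := by
      rw [sub_eq_add_neg, zpow_add₀ (by norm_num), neg_one_zpow_neg s]; norm_num
    have g3 : t^(12*s^2+12*s+2) / t^(8*s+2) = t^(2*((2*(-1-s)+1)*(2*(-1-s)+1+1))) * (t^((2*(-1-s)+1)*(2*(-1-s)+1+1)+2) * t^(2*(-1-s))) := by
      rw [← zpow_sub₀ ht, ← zpow_add₀ ht, ← zpow_add₀ ht]; congr 1; ring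
    rw [uT, sqz, pN, g1, g2, mul_div_assoc, g3]
    ring
  rw [mul_sub (sg t 1), div_mul_eq_div_div, div_eq_mul_inv (pN t s / t^(8*s+2))]
  linear_combination (sg t 1) * (1 + z^2 * t^(8*s+2))⁻¹ * k1 + (sg t 1) * (1 + z ^ 2 * t ^ (2*(-(4*s+1))))⁻¹ * k2

theorem norm_of_pow4 {z : ℂ} (hz : z^4 = -1) : ‖z‖ = 1 := by
  have : ‖z‖^4 = 1 := by rw [← norm_pow, hz]; simp
  exact (pow_eq_one_iff_of_nonneg (norm_nonneg _) (by norm_num)).1 this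

theorem lb4 {z : ℂ} (hz : z^4 = -1) (x : ℝ) (hx : 0 < x) : 1/4 ≤ ‖1 - z * x‖ := by
  have h1 := norm_of_pow4 hz
  have e : (1 - z * x) * ((1 + z * x) * (1 + z^2 * x^2)) = ((1 + x^4 : ℝ) : ℂ) := by
    push_cast; linear_combination (-(x:ℂ)^4) * hz
  have e2 := congrArg norm e
  rw [norm_mul, norm_mul, Complex.norm_real, Real.norm_of_nonneg (by positivity)] at e2
  have b1 : ‖1 + z * x‖ ≤ 1 + x := by
    refine (norm_add_le _ _).trans ?_
    simp [h1, abs_of_pos hx]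
  have b2 : ‖1 + z^2 * x^2‖ ≤ 1 + x^2 := by
    refine (norm_add_le _ _).trans ?_
    simp [h1]
  have b3 : ‖1 + z * x‖ * ‖1 + z^2 * x^2‖ ≤ (1+x)*(1+x^2) :=
    mul_le_mul b1 b2 (norm_nonneg _) (by positivity)
  have b4 : (1+x)*(1+x^2) ≤ 4 * (1+x^4) := by nlinarith [sq_nonneg (x^2-x), sq_nonneg (x-1), sq_nonneg (x^2-1), mul_pos hx hx]
  have b5 : 1 + x^4 ≤ ‖1 - z*x‖ * (4 * (1+x^4)) := by
    rw [← e2]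
    nth_rewrite 1 [e2]
    rw [← e2]
    exact mul_le_mul_of_nonneg_left (by rw [e2]; exact b3.trans b4) (norm_nonneg _)
  have : 0 < 1 + x^4 := by positivity
  nlinarith

theorem lb2 {z : ℂ} (hz : z^2 = -1) (x : ℝ) (hx : 0 < x) : 1/4 ≤ ‖1 + z * x‖ := by
  have hz4 : z^4 = 1 := by rw [show 4 = 2*2 by rfl, pow_mul, hz]; norm_num
  have h1 : ‖z‖ = 1 := by
    have : ‖z‖^4 = 1 := by rw [← norm_pow, hz4]; simp
    exact (pow_eq_one_iff_of_nonneg (norm_nonneg _) (by norm_num)).1 this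
  have e : (1 + z * x) * (1 - z * x) = ((1 + x^2 : ℝ) : ℂ) := by
    push_cast; linear_combination (-(x:ℂ)^2) * hz
  have e2 := congrArg norm e
  rw [norm_mul, Complex.norm_real, Real.norm_of_nonneg (by positivity)] at e2
  have b1 : ‖1 - z * x‖ ≤ 1 + x := by
    refine (norm_sub_le _ _).trans ?_
    simp [h1, abs_of_pos hx]
  have b5 : 1 + x^2 ≤ ‖1 + z*x‖ * (1 + x) := by
    rw [← e2]
    exact mul_le_mul_of_nonneg_left b1 (norm_nonneg _)
  have := norm_nonneg (1 + z*x)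
  by_contra h
  push Not at h
  nlinarith [sq_nonneg (x-1), mul_pos hx hx]

theorem lb1 (x : ℝ) (hx : 0 < x) : 1/4 ≤ ‖(1:ℂ) + x‖ := by
  rw [show (1:ℂ) + x = ((1 + x : ℝ):ℂ) by push_cast; rfl, Complex.norm_real, Real.norm_of_nonneg (by positivity)]
  linarith

theorem bd4 {T : ℝ} (h0 : 0 < T) (h1 : T < 1) {z : ℂ} (hz : z^4 = -1) : Bd (T:ℂ) z (1/4) where
  t0 := by exact_mod_cast h0.ne'
  t1 := by rwa [Complex.norm_real, Real.norm_of_nonneg h0.le]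
  z0 := by rintro rfl; norm_num at hz
  c0 := by norm_num
  b1 n := by simpa using lb4 hz (T^(2*n)) (zpow_pos h0 _)
  b2 n := by simpa using lb2 (z := z^2) (by rw [← pow_mul, hz]) (T^(2*n)) (zpow_pos h0 _)
  b3 n := by simpa using lb1 (T^(2*n)) (zpow_pos h0 _)

theorem bdm {T : ℝ} (h0 : 0 < T) (h1 : T < 1) : Bd (T:ℂ) (-1) (1/4) where
  t0 := by exact_mod_cast h0.ne'
  t1 := by rwa [Complex.norm_real, Real.norm_of_nonneg h0.le]
  z0 := by norm_num
  c0 := by norm_num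
  b1 n := by simpa using lb1 (T^(2*n)) (zpow_pos h0 _)
  b2 n := by simpa using lb1 (T^(2*n)) (zpow_pos h0 _)
  b3 n := by simpa using lb1 (T^(2*n)) (zpow_pos h0 _)

/-- Elementary facts on products, base t. q = t^2. -/
theorem Bd.q1 {t z : ℂ} {c : ℝ} (H : Bd t z c) : ‖t^2‖ < 1 := norm_sq_lt H.t1

-- product facts
theorem pf1 {q : ℂ} (h : ‖q‖ < 1) : qp q q = qp q (q^2) * qp (q^2) (q^2) := by
  rw [qp_split q h, ← sq]

theorem pf2 {q : ℂ} (h : ‖q‖ < 1) : qp q q * qp (-q) q = qp (q^2) (q^2) := qp_mul_neg q h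

theorem pf3 {q : ℂ} (h : ‖q‖ < 1) : qp (-q) q = qp (-q) (q^2) * qp (-(q^2)) (q^2) := by
  rw [qp_split (-q) h, neg_mul, ← sq]

theorem pf4 {q : ℂ} (h : ‖q‖ < 1) : qp q (q^2) * qp (-q) (q^2) = qp (q^2) ((q^2)^2) := 
  qp_mul_neg q (norm_sq_lt h)

/-- E1 E4 (-q;q^2) = E2^2 -/
theorem pf5 {q : ℂ} (h : ‖q‖ < 1) : qp q q * qp ((q^2)^2) ((q^2)^2) * qp (-q) (q^2) = qp (q^2) (q^2) ^ 2 := by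
  have a := pf1 h
  have b := pf4 h
  have c := pf1 (norm_sq_lt h)
  rw [a, sq (qp (q^2) (q^2))]
  nth_rewrite 3 [c]
  rw [← b]; ring

theorem aT_B {t z : ℂ} {c : ℝ} (H : Bd t z c) : 
    (∑' m : ℤ, aT (-(z^2*t^2)) (t^2) m) * (qp (-(z^2*t^2)) ((t^2)^2) * qp (-(t^2/z^2)) ((t^2)^2)) =
      qp ((t^2)^2) ((t^2)^2) ^ 2 := by
  have ht := H.t0
  have hz := H.z0
  have h := f1 (z := -(z^2*t^2)) (t := t^2) (pow_ne_zero 2 ht) H.q1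
    (neg_ne_zero.2 (mul_ne_zero (pow_ne_zero 2 hz) (pow_ne_zero 2 ht))) ⟨c, H.c0, fun n => by
      have := H.b2 (2*n+1)
      rwa [show 1 - -(z^2*t^2)*((t^2)^2)^n = 1 + z^2 * t^(2*(2*n+1)) by
        rw [sqz, sqz, show 2*(2*n+1) = 2*(2*n) + 2 by ring, zpow_add₀ ht]; norm_cast; ring]⟩
  rw [show (t^2)^2/(-(z^2*t^2)) = -(t^2/z^2) by field_simp] at h
  exact h

theorem B1_eq {t : ℂ} (ht : t ≠ 0) : B1 t = ∑' m : ℤ, aT (-((-1)^2*t^2)) (t^2) m := by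
  refine tsum_congr fun l => ?_
  rw [aT, uT, sqz, sqz, sqz, show 2*(2*l) = 4 * l by ring, zpow_add₀ ht, neg_one_sq]
  norm_cast
  congr 1; ring

/-- value of B(1) -/
theorem B1_val {t : ℂ} {c : ℝ} (H : Bd t (-1) c) : B1 t * qp (-(t^2)) ((t^2)^2) ^ 2 = qp ((t^2)^2) ((t^2)^2) ^ 2 := by
  have := aT_B H
  rw [← B1_eq H.t0] at this
  simpa [sq (qp (-(t^2)) ((t^2)^2))] using this

theorem beta_val {t z : ℂ} {c : ℝ} (H : Bd t z c) (hz : z^4 = -1) :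
    (∑' m : ℤ, aT (-(z^2*t^2)) (t^2) m) * qp (-((t^2)^2)) (((t^2)^2)^2) = qp ((t^2)^2) ((t^2)^2) ^ 2 := by
  have h := aT_B H
  have hz0 := H.z0
  have e : -(t^2/z^2) = z^2*t^2 := by
    rw [neg_div', div_eq_iff (pow_ne_zero 2 hz0)]; linear_combination (-t^2) * hz
  rw [e, mul_comm (qp (-_) _), qp_mul_neg _ (norm_sq_lt H.q1)] at h
  rw [← h]
  congr 2
  linear_combination -t^4 * hz

/-- value of A(z) -/
theorem A_val {t z : ℂ} {c : ℝ} (H : Bd t z c) :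
    (∑' n : ℤ, aT z t n) * ((1 - z) * qp (z * t^2) (t^2) * qp (t^2/z) (t^2)) = qp (t^2) (t^2) ^ 2 := by
  have h := f1 H.t0 H.t1 H.z0 ⟨c, H.c0, fun n => by rw [sqz]; exact H.b1 n⟩
  rwa [qp_rec z H.q1] at h

theorem sg1_val {T : ℝ} (h0 : 0 < T) (h1 : T < 1) :
    sg (T:ℂ) 1 * qp (-((T:ℂ)^2)) (((T:ℂ)^2)^2) = qp ((T:ℂ)^2) ((T:ℂ)^2) ^ 2 := by
  have H := bdm h0 h1
  have ht := H.t0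
  have hI : (Complex.I)^2 = -1 := Complex.I_sq
  have hb : ∀ n : ℤ, 1 - Complex.I / (T:ℂ) * ((T:ℂ)^2)^n = 1 + (-Complex.I) * ((T^(2*n-1) : ℝ) : ℂ) := fun n => by
    rw [sqz]; push_cast; rw [zpow_sub_one₀ ht]; field_simp; ring
  have hb' : ∀ n : ℤ, 1/4 ≤ ‖1 - Complex.I / (T:ℂ) * ((T:ℂ)^2)^n‖ := fun n => by
    rw [hb]; exact lb2 (by simp) _ (zpow_pos h0 _)
  have f := f1 (z := Complex.I / T) ht H.t1 (div_ne_zero Complex.I_ne_zero ht) ⟨1/4, by norm_num, hb'⟩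
  generalize (T:ℂ) = t at *
  have e : ∑' n : ℤ, aT (Complex.I / t) t n = Complex.I * t * sg t 1 := by
    have s : HasSum _ (t^2 * sg t 0 + Complex.I * t * sg t 1) := ((sg_summ H 0).hasSum.mul_left (t^2)).add ((sg_summ H 1).hasSum.mul_left (Complex.I * t))
    rw [sg_zero H, mul_zero (_ ^ 2), zero_add] at s
    refine (s.cg (fun n => ?_) rfl).tsum_eq
    have d := sg_den H n
    have d2 : 1 - Complex.I / t * (t^2)^n ≠ 0 := norm_pos_iff.1 (lt_of_lt_of_le (by norm_num) (hb' n))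
    rw [aT, ← uT]
    rw [sqz] at *
    rw [show 4*n = 2*n+2*n by ring, zpow_add₀ ht] at *
    simp only [mul_zero, zero_mul, zpow_zero, mul_one]
    generalize t^(2*n) = x at *
    have d3 : t - Complex.I * x ≠ 0 := fun h => d2 (by field_simp; simp [h])
    have e3 : 1 - Complex.I / t * x = (t - Complex.I * x) / t := by field_simp
    rw [e3]
    rw [← sq] at d ⊢
    field_simp
    linear_combination (x^2*uT t n) * hI
  rw [e] at f
  have r1 := qp_rec (Complex.I / t) H.q1
  have r2 := qp_rec (-(Complex.I * t)) H.q1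
  have r3 := qp_mul_neg (Complex.I * t) H.q1
  have e1 : Complex.I / t * t^2 = Complex.I * t := by field_simp
  have e2 : t^2/(Complex.I/t) = -(Complex.I * t) * t^2 := by
    field_simp; rw [hI]; ring
  have e3 : (Complex.I * t)^2 = -(t^2) := by rw [mul_pow, hI]; ring
  rw [e2, r1, e1] at f
  rw [e3] at r3
  rw [← r3, r2, ← f]
  generalize qp (Complex.I * t) (t^2) = P1
  generalize qp (-(Complex.I*t) * t^2) (t^2) = P2
  field_simp
  linear_combination (P1 * P2 * sg t 1) * hI

theorem summable_zg {t : ℂ} (h0 : t ≠ 0) (h1 : ‖t‖ < 1) (a b c : ℤ) (ha : 0 < a) :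
    Summable fun n : ℤ => ‖(-1:ℂ)^n * t^(a*n^2+b*n+c)‖ := by
  refine (summable_gauss_real (norm_pos_iff.2 h0) h1 a b c ha).congr fun n => ?_
  simp

theorem kT_norm {t z : ℂ} {c : ℝ} (H : Bd t z c) : Summable fun n : ℤ => ‖kT t z n‖ := by
  refine (summable_bdd c⁻¹ (summable_zg H.t0 H.t1 3 1 0 (by norm_num))
    (fun n => inv_norm_le H.c0 (H.b1 n))).congr fun n => ?_
  rw [kT, div_eq_mul_inv, show n*(3*n+1) = 3*n^2+1*n+0 by ring]

theorem pN_norm {t : ℂ} (h0 : t ≠ 0) (h1 : ‖t‖ < 1) : Summable fun n : ℤ => ‖pN t n‖ :=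
  summable_zg h0 h1 12 12 2 (by norm_num)

theorem pNd1 {t z : ℂ} {c : ℝ} (H : Bd t z c) : Summable fun s : ℤ => pN t s / (1 + z^2 * t^(8*s+2)) := by
  refine (summable_bdd c⁻¹ (pN_norm H.t0 H.t1)
    (fun n => inv_norm_le H.c0 (H.b2 (4*n+1)))).of_norm.congr fun n => ?_
  rw [div_eq_mul_inv, show 2*(4*n+1) = 8*n+2 by ring]

theorem inv4 {z : ℂ} (hz : z^4 = -1) : z⁻¹ = -z^3 := by
  have : z ≠ 0 := by rintro rfl; norm_num at hz
  field_simp; linear_combination hz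

theorem pNd2 {T : ℝ} (h0 : 0 < T) (h1 : T < 1) {z : ℂ} (hz : z^4 = -1) : 
    Summable fun s : ℤ => pN (T:ℂ) s / (z^2 + (T:ℂ)^(8*s+2)) := by
  have H := bd4 h0 h1 (z := z⁻¹) (by rw [inv_pow, hz]; norm_num)
  refine ((pNd1 H).mul_left (z⁻¹^2)).congr fun s => ?_
  have z0 : z ≠ 0 := by rintro rfl; norm_num at hz
  have := H.n2 (4*s+1)
  rw [show 2*(4*s+1) = 8*s+2 by ring] at this
  generalize (T:ℂ)^(8*s+2) = y at *
  have h : z^2 + y = z^2 * (1 + z⁻¹^2 * y) := by field_simp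
  rw [h]
  field_simp

/-- theta pieces -/
noncomputable def Rz (t : ℂ) : ℂ := ∑' l : ℤ, (-1)^l * t^(4*l*(4*l-1))
/-- alternating theta -/
noncomputable def Thm (t : ℂ) : ℂ := ∑' l : ℤ, (-1)^l * t^((4*l+2)*(4*l+1))
/-- positive theta -/
noncomputable def Thp (t : ℂ) : ℂ := ∑' l : ℤ, t^((4*l+2)*(4*l+1))
/-- phi -/
noncomputable def phip (t : ℂ) : ℂ := ∑' l : ℤ, t^(2*l^2)
/-- phi(-q) -/
noncomputable def phim (t : ℂ) : ℂ := ∑' l : ℤ, (-1)^l * t^(2*l^2)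

theorem Rz_summ {t : ℂ} (h0 : t ≠ 0) (h1 : ‖t‖ < 1) : Summable fun l : ℤ => (-1:ℂ)^l * t^(4*l*(4*l-1)) :=
  (summable_zg h0 h1 16 (-4) 0 (by norm_num)).of_norm.congr fun l => by congr 2; ring

theorem Thm_summ {t : ℂ} (h0 : t ≠ 0) (h1 : ‖t‖ < 1) : Summable fun l : ℤ => (-1:ℂ)^l * t^((4*l+2)*(4*l+1)) :=
  (summable_zg h0 h1 16 (12) 2 (by norm_num)).of_norm.congr fun l => by congr 2; ring

theorem zp4 {z : ℂ} (hz : z^4 = -1) (l : ℤ) : z^(4*l) = (-1)^l := by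
  rw [zpow_mul, show z^(4:ℤ) = z^4 from by norm_cast, hz]

theorem Pi_val {t z : ℂ} {c : ℝ} (H : Bd t z c) (hz : z^4 = -1) :
    qp (t^2) (t^2) * (qp (z*t^2) (t^2) * qp (t^2/z) (t^2)) = Rz t - (z⁻¹ + 1 + z) * Thm t := by
  have ht := H.t0
  have z0 := H.z0
  have hj := jtp H.t0 H.t1 H.z0
  have hs := (w_norm H.t0 H.t1 H.z0).of_norm
  have i1 : Function.Injective fun s : ℤ => 2*s := fun a b h => by simp only at h; omega
  have i2 : Function.Injective fun s : ℤ => 2*s+1 := fun a b h => by simp only at h; omega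
  have hv := hj.tsum_eq
  generalize hF : w z t = F at *
  have j1 : Summable fun s : ℤ => F (2*s) := hs.comp_injective i1
  have j2 : Summable fun s : ℤ => F (2*s+1) := hs.comp_injective i2
  have j3 : Summable fun s : ℤ => F (2*(0-s)+1) := by
    have h := (Equiv.subLeft (0:ℤ)).summable_iff.2 j2
    simpa only [Function.comp_def, Equiv.subLeft_apply] using h
  rw [tsum_even_odd hs, j1.tsum_add j2, ← (Equiv.subLeft (0:ℤ)).tsum_eq (fun s => F (2*s+1))] at hv
  simp only [Equiv.subLeft_apply] at hv
  rw [← j1.tsum_add j3, tsum_even_odd (j1.add j3)] at hv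
  have e : ∀ s : ℤ, (F (2*(2*s)) + F (2*(0-2*s)+1)) + (F (2*(2*s+1)) + F (2*(0-(2*s+1))+1)) =
      (1-z) * ((-1)^s * t^(4*s*(4*s-1))) - (1-z)*(z⁻¹+1+z) * ((-1)^s * t^((4*s+2)*(4*s+1))) := by
    intro s
    rw [← hF]
    simp only [w]
    rw [show 2*(2*s)*(2*(2*s)-1) = 4*s*(4*s-1) by ring, show (2*(0-2*s)+1)*(2*(0-2*s)+1-1) = 4*s*(4*s-1) by ring,
      show (2*(2*s+1))*(2*(2*s+1)-1) = (4*s+2)*(4*s+1) by ring, show (2*(0-(2*s+1))+1)*(2*(0-(2*s+1))+1-1) = (4*s+2)*(4*s+1) by ring]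
    have nz : (-z) ≠ 0 := neg_ne_zero.2 z0
    have nz4 : (-z)^4 = -1 := by rw [← hz]; ring
    have a1 : (-z)^(2*(2*s)) = (-1)^s := by rw [← zp4 nz4]; congr 1; ring
    have a2 : (-z)^(2*(0-2*s)+1) = -z * (-1)^s := by 
      rw [← neg_one_zpow_neg s, ← zp4 nz4, zpow_add_one₀ nz, mul_comm]; congr 2; ring
    have a3 : (-z)^(2*(2*s+1)) = z^2*(-1)^s := by 
      rw [← zp4 nz4, show 2*(2*s+1) = 4*s+2 by ring, zpow_add₀ nz, mul_comm]; congr 1; norm_cast; ring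
    have a4 : (-z)^(2*(0-(2*s+1))+1) = -z⁻¹ * (-1)^s := by 
      rw [← neg_one_zpow_neg s, ← zp4 nz4, show 2*(0-(2*s+1))+1 = 4*(-s) - 1 by ring, zpow_sub_one₀ nz, mul_comm, inv_neg]
    rw [a1, a2, a3, a4]
    generalize t^(4*s*(4*s-1)) = u
    generalize t^((4*s+2)*(4*s+1)) = v
    field_simp
    ring
  rw [tsum_congr e, ((Rz_summ H.t0 H.t1).mul_left _).tsum_sub ((Thm_summ H.t0 H.t1).mul_left _), tsum_mul_left, tsum_mul_left,
    ← Rz, ← Thm, qp_rec z H.q1] at hv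
  have : 1 - z ≠ 0 := by simpa using H.n1 0
  apply mul_left_cancel₀ this
  linear_combination -hv

theorem alpha_val {T : ℝ} (h0 : 0 < T) (h1 : T < 1) {z : ℂ} (hz : z^4 = -1) :
   ((1 - z⁻¹) * (∑' n : ℤ, aT z T n) + (1 - z) * (∑' n : ℤ, aT z⁻¹ T n) + 
     (1 + z⁻¹) * (∑' n : ℤ, aT (-z) T n) + (1 + z) * (∑' n : ℤ, aT (-z⁻¹) T n)) *
      qp (-(((T:ℂ)^2)^2)^2) ((((T:ℂ)^2)^2)^2) = -4 * qp ((T:ℂ)^2) ((T:ℂ)^2) * Thm T := by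
  have z0 : z ≠ 0 := by rintro rfl; norm_num at hz
  have hzi : z⁻¹^4 = -1 := by rw [inv_pow, hz]; norm_num
  have hzn : (-z)^4 = -1 := by rw [← hz]; ring
  have hzm : (-z⁻¹)^4 = -1 := by rw [← hzi]; ring
  have H1 := bd4 h0 h1 hz
  have H2 := bd4 h0 h1 hzi
  have H3 := bd4 h0 h1 hzn
  have H4 := bd4 h0 h1 hzm
  have hq := H1.q1
  have A1 := A_val H1
  have A2 := A_val H2
  have A3 := A_val H3
  have A4 := A_val H4
  have P1 := Pi_val H1 hz
  have P3 := Pi_val H3 hzn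
  have d1 : 1 - z ≠ 0 := by simpa using H1.n1 0
  have d3 : 1 + z ≠ 0 := by simpa using H3.n1 0
  generalize (T:ℂ) = t at *
  rw [div_inv_eq_mul, mul_comm z⁻¹, ← div_eq_mul_inv, mul_comm (t^2) z] at A2
  rw [show -z⁻¹ * t^2 = t^2/(-z) by field_simp, show t^2/(-z⁻¹) = -z*t^2 by field_simp] at A4
  generalize (∑' n : ℤ, aT z t n) = a1 at *
  generalize (∑' n : ℤ, aT z⁻¹ t n) = a2 at *
  generalize (∑' n : ℤ, aT (-z) t n) = a3 at *
  generalize (∑' n : ℤ, aT (-z⁻¹) t n) = a4 at *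
  have E0 : qp (t^2) (t^2) ≠ 0 := qpq_ne hq
  have p1 : qp (z * t^2) (t^2) * qp (-(z * t^2)) (t^2) = _ := qp_mul_neg (z*t^2) hq
  have p2 : qp (t^2/z) (t^2) * qp (-(t^2/z)) (t^2) = _ := qp_mul_neg (t^2/z) hq
  have p3 := qp_mul_neg ((z*t^2)^2) (norm_sq_lt hq)
  rw [show -(z*t^2)^2 = (t^2/z)^2 by field_simp; linear_combination -t^4*hz, ← p1, ← p2, 
     show ((z*t^2)^2)^2 = -((t^2)^2)^2 by linear_combination t^8*hz] at p3
  rw [show -(z*t^2) = -z*t^2 by ring, show -(t^2/z) = t^2/(-z) by field_simp] at p3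
  rw [← p3]
  generalize qp (z*t^2) (t^2) = x1 at *
  generalize qp (-z*t^2) (t^2) = x2 at *
  generalize qp (t^2/z) (t^2) = x3 at *
  generalize qp (t^2/(-z)) (t^2) = x4 at *
  generalize qp (t^2) (t^2) = E at *
  have b1 : (1 - z⁻¹) * a1 * (x1*x3) = - z⁻¹ * E^2 := by
    rw [← A1]; field_simp; ring
  have b2 : (1 - z) * a2 * (x1*x3) = - z * E^2 := by
    rw [← A2]; field_simp; ring
  have b3 : (1 + z⁻¹) * a3 * (x2*x4) = z⁻¹ * E^2 := by
    rw [← A3]; field_simp; ring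
  have b4 : (1 + z) * a4 * (x2*x4) = z * E^2 := by
    rw [← A4]; field_simp; ring
  have s2 : (z + z⁻¹)^2 = 2 := by field_simp; linear_combination hz
  rw [inv_neg] at P3
  linear_combination x2*x4*(b1+b2) + x1*x3*(b3+b4) + (z+z⁻¹)*E*(P1 - P3) - 2*E*Thm t * s2

/-- the collected rank term -/
noncomputable def gT (t : ℂ) (n : ℤ) : ℂ := (-1)^n * t^(n*(3*n+1)) * (1 - t^(2*n)) / (1 + (t^(2*n))^4)

theorem G_val {T : ℝ} (h0 : 0 < T) (h1 : T < 1) {z : ℂ} (hz : z^4 = -1) :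
   HasSum (fun n => 4 * gT T n) ((1 - z⁻¹) * (∑' n : ℤ, kT T z n) + (1 - z) * (∑' n : ℤ, kT T z⁻¹ n) + 
     (1 + z⁻¹) * (∑' n : ℤ, kT T (-z) n) + (1 + z) * (∑' n : ℤ, kT T (-z⁻¹) n)) := by
  have z0 : z ≠ 0 := by rintro rfl; norm_num at hz
  have hzi : z⁻¹^4 = -1 := by rw [inv_pow, hz]; norm_num
  have hzn : (-z)^4 = -1 := by rw [← hz]; ring
  have hzm : (-z⁻¹)^4 = -1 := by rw [← hzi]; ring
  have H1 := bd4 h0 h1 hz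
  have H2 := bd4 h0 h1 hzi
  have H3 := bd4 h0 h1 hzn
  have H4 := bd4 h0 h1 hzm
  have S1 := (kT_norm H1).of_norm.hasSum.mul_left (1 - z⁻¹)
  have S2 := (kT_norm H2).of_norm.hasSum.mul_left (1 - z)
  have S3 := (kT_norm H3).of_norm.hasSum.mul_left (1 + z⁻¹)
  have S4 := (kT_norm H4).of_norm.hasSum.mul_left (1 + z)
  refine (((S1.add S2).add S3).add S4).cg (fun n => ?_) rfl
  have n1 := H1.n1 n
  have n2 := H2.n1 n
  have n3 := H3.n1 n
  have n4 := H4.n1 n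
  simp only [gT, kT]
  generalize (T:ℂ)^(2*n) = x at *
  generalize (-1)^n * (T:ℂ)^(n*(3*n+1)) = u at *
  have D : 1 + x^4 ≠ 0 := by
    have e : 1 + x^4 = (1 - z*x)*(1 - -z*x)*(1 - z⁻¹*x)*(1 - -z⁻¹*x) := by
      rw [inv4 hz]; linear_combination (-x^4*z^4 + x^2*z^2+x^4)*hz
    rw [e]
    exact mul_ne_zero (mul_ne_zero (mul_ne_zero n1 n3) n2) n4
  have key : ∀ v : ℂ, v^4 = -1 → 1 - v * x ≠ 0 → u / (1 - v*x) = u * (1 + v*x + v^2*x^2+v^3*x^3) / (1+x^4) := by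
    intro v hv h
    rw [div_eq_div_iff h D]; linear_combination (u*x^4)*hv
  rw [key z hz n1, key _ hzi n2, key _ hzn n3, key _ hzm n4, inv4 hz]
  field_simp
  ring_nf
  have z4 := hz
  have z5 : z^5 = -z := by linear_combination z*hz
  have z6 : z^6 = -z^2 := by linear_combination z^2*hz
  have z7 : z^7 = -z^3 := by linear_combination z^3*hz
  have z9 : z^9 = z := by linear_combination (z^5-z)*hz
  have z10 : z^10 = z^2 := by linear_combination (z^6-z^2)*hz
  simp only [z4,z6,z10]
  ring



theorem phip_val {t : ℂ} (h0 : t ≠ 0) (h1 : ‖t‖ < 1) :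
    phip t = qp (-(t^2)) ((t^2)^2) ^ 2 * qp ((t^2)^2) ((t^2)^2) := by
  have ht2 : t^2 ≠ 0 := pow_ne_zero 2 h0
  have h := (jtp (z := -(t^2)) ht2 (norm_sq_lt h1) (neg_ne_zero.2 ht2)).tsum_eq
  rw [show (t^2)^2/(-(t^2)) = -(t^2) by field_simp, ← sq] at h
  rw [← h]
  refine tsum_congr fun n => ?_
  rw [w, neg_neg, ← zpow_add₀ ht2, sqz]; congr 1; ring

theorem phim_val {t : ℂ} (h0 : t ≠ 0) (h1 : ‖t‖ < 1) :
    phim t = qp (t^2) ((t^2)^2) ^ 2 * qp ((t^2)^2) ((t^2)^2) := by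
  have ht2 : t^2 ≠ 0 := pow_ne_zero 2 h0
  have h := (jtp (z := t^2) ht2 (norm_sq_lt h1) ht2).tsum_eq
  rw [show (t^2)^2/(t^2) = t^2 by field_simp, ← sq] at h
  rw [← h]
  refine tsum_congr fun n => ?_
  rw [w, neg_eq_neg_one_mul (t^2), mul_zpow, mul_assoc, ← zpow_add₀ ht2, sqz]; congr 2; ring

theorem Thp_val {t : ℂ} (h0 : t ≠ 0) (h1 : ‖t‖ < 1) :
    2 * Thp t = (qp (-(t^2)) ((t^2)^2) - qp (t^2) ((t^2)^2)) * qp (((t^2)^2)^2) (((t^2)^2)^2) := by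
  have ht2 : t^2 ≠ 0 := pow_ne_zero 2 h0
  have ht4 : (t^2)^2 ≠ 0 := pow_ne_zero 2 ht2
  have hq := norm_sq_lt h1
  have hq2 := norm_sq_lt hq
  have a := jtp (z := t^2) ht4 hq2 ht2
  have b := jtp (z := -(t^2)) ht4 hq2 (neg_ne_zero.2 ht2)
  have sa := a.summable
  have sb := b.summable
  have c := b.sub a
  rw [show ((t^2)^2)^2/(t^2) = t^2 * (t^2)^2 by field_simp, show ((t^2)^2)^2/(-(t^2)) = -(t^2) * (t^2)^2 by field_simp,
    ← qp_split _ hq2, ← qp_split _ hq2, ← sub_mul] at c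
  rw [← c.tsum_eq, tsum_even_odd c.summable, Thp, ← tsum_mul_left]
  refine tsum_congr fun s => ?_
  have e1 : w (-(t^2)) ((t^2)^2) (2*s) - w (t^2) ((t^2)^2) (2*s) = 0 := by
    simp only [w]
    rw [neg_neg, neg_eq_neg_one_mul (t^2), mul_zpow, neg_one_zpow_two]; ring
  have e2 : w (-(t^2)) ((t^2)^2) (2*s+1) - w (t^2) ((t^2)^2) (2*s+1) = 2 * ((t^2)^(2*s+1) * ((t^2)^2)^((2*s+1)*(2*s+1-1))) := by
    simp only [w]
    rw [neg_neg, neg_eq_neg_one_mul (t^2), mul_zpow, zpow_add₀ (by norm_num : (-1:ℂ) ≠ 0) (2*s), neg_one_zpow_two, zpow_one]; ring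
  rw [e1, e2, zero_add, sqz, sqz, sqz, ← zpow_add₀ h0]
  congr 2; ring

theorem Y_id {T : ℝ} (h0 : 0 < T) (h1 : T < 1) {z : ℂ} (hz : z^4 = -1) :
  (1 - z⁻¹) * (∑' s : ℤ, (z * (pN T s / (1 + z^2 * (T:ℂ)^(8*s+2))) - pN T s / (z^2 + (T:ℂ)^(8*s+2)))) +
  (1 - z) * (∑' s : ℤ, (z⁻¹ * (pN T s / (1 + z⁻¹^2 * (T:ℂ)^(8*s+2))) - pN T s / (z⁻¹^2 + (T:ℂ)^(8*s+2)))) +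
  (1 + z⁻¹) * (∑' s : ℤ, (-z * (pN T s / (1 + (-z)^2 * (T:ℂ)^(8*s+2))) - pN T s / ((-z)^2 + (T:ℂ)^(8*s+2)))) +
  (1 + z) * (∑' s : ℤ, (-z⁻¹ * (pN T s / (1 + (-z⁻¹)^2 * (T:ℂ)^(8*s+2))) - pN T s / ((-z⁻¹)^2 + (T:ℂ)^(8*s+2)))) 
  + 2 * (∑' s : ℤ, (-1 * (pN T s / (1 + (-1)^2 * (T:ℂ)^(8*s+2))) - pN T s / ((-1)^2 + (T:ℂ)^(8*s+2))))
   = - 8 * ∑' s : ℤ, pN T s * (1 - (T:ℂ)^(3*(8*s+2)))/(1 - (T:ℂ)^(4*(8*s+2))) := by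
  have z0 : z ≠ 0 := by rintro rfl; norm_num at hz
  have hzi : z⁻¹^4 = -1 := by rw [inv_pow, hz]; norm_num
  have hzn : (-z)^4 = -1 := by rw [← hz]; ring
  have hzm : (-z⁻¹)^4 = -1 := by rw [← hzi]; ring
  have S : ∀ {v : ℂ}, v^4 = -1 → Summable fun s : ℤ => (v * (pN T s / (1 + v^2 * (T:ℂ)^(8*s+2))) - pN T s / (v^2 + (T:ℂ)^(8*s+2))) :=
    fun hv => ((pNd1 (bd4 h0 h1 hv)).mul_left _).sub (pNd2 h0 h1 hv)
  have S0 : Summable fun s : ℤ => (-1 * (pN T s / (1 + (-1)^2 * (T:ℂ)^(8*s+2))) - pN T s / ((-1)^2 + (T:ℂ)^(8*s+2))) := by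
    have := pNd1 (bdm h0 h1)
    refine (this.mul_left (-1)).sub (this.congr fun s => ?_)
    rw [neg_one_sq, one_mul]
  simp only [← tsum_mul_left]
  rw [← ((S hz).mul_left _).tsum_add ((S hzi).mul_left _), ← (((S hz).mul_left _).add ((S hzi).mul_left _)).tsum_add ((S hzn).mul_left _),
     ← ((((S hz).mul_left _).add ((S hzi).mul_left _)).add ((S hzn).mul_left _)).tsum_add ((S hzm).mul_left _), 
     ← (((((S hz).mul_left _).add ((S hzi).mul_left _)).add ((S hzn).mul_left _)).add ((S hzm).mul_left _)).tsum_add (S0.mul_left _)]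
  refine tsum_congr fun s => ?_
  have d1 := (bd4 h0 h1 hz).n2 (4*s+1)
  have d2 := (bd4 h0 h1 hzi).n2 (4*s+1)
  have d3 := (bdm h0 h1).n3 (4*s+1)
  rw [show 2*(4*s+1) = 8*s+2 by ring] at *
  rw [mul_comm 3, mul_comm 4, zpow_mul, zpow_mul]
  have hy1 : (T:ℂ)^(8*s+2) ≠ 1 := by
    intro h
    have : T^(8*s+2) = 1 := by exact_mod_cast h
    have := (zpow_eq_one_iff_right₀ h0.le h1.ne).1 this
    omega
  generalize (T:ℂ)^(8*s+2) = y at *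
  rw [show y^(3:ℤ) = y^3 by norm_cast, show y^(4:ℤ) = y^4 by norm_cast]
  generalize pN T s = p
  have i2 : z⁻¹^2 = -z^2 := by rw [inv4 hz]; linear_combination z^2*hz
  have hD : 1 + y^2 ≠ 0 := by
    have := mul_ne_zero d1 d2
    rw [i2] at this
    rwa [show (1 + z^2*y)*(1 + -z^2*y) = 1 + y^2 by linear_combination (-y^2)*hz] at this
  have k1 : p / (1 + z^2*y) = p * (1 - z^2*y)/(1+y^2) := by
    rw [div_eq_div_iff d1 hD]; linear_combination p*y^2*hz
  have k2 : p / (1 + -z^2*y) = p * (1 + z^2*y)/(1+y^2) := by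
    rw [i2] at d2
    rw [div_eq_div_iff d2 hD]; linear_combination p*y^2*hz
  have k3 : p / (z^2+y) = p * (y-z^2)/(1+y^2) := by
    have : z^2 + y ≠ 0 := by
      intro h; apply hD; linear_combination (y-z^2)*h+hz
    rw [div_eq_div_iff this hD]; linear_combination p*hz
  have k4 : p / (-z^2+y) = p * (y+z^2)/(1+y^2) := by
    have : -z^2 + y ≠ 0 := by
      intro h; apply hD; linear_combination (y+z^2)*h+hz
    rw [div_eq_div_iff this hD]; linear_combination p*hz
  have hy2 : 1 - y^4 ≠ 0 := by
    rw [show 1 - y^4 = (1-y)*(1+y)*(1+y^2) by ring]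
    exact mul_ne_zero (mul_ne_zero (sub_ne_zero.2 (Ne.symm hy1)) d3) hD
  have k5 : p * (1 - y^3)/(1-y^4) = p*(1+y+y^2)/((1+y)*(1+y^2)) := by
    rw [div_eq_div_iff hy2 (mul_ne_zero d3 hD)]; ring
  rw [neg_sq, neg_sq, i2, k1, k2, k3, k4, k5, inv4 hz]
  simp only [neg_one_sq, one_mul]
  field_simp
  ring_nf
  simp only [hz]
  ring

theorem main_id {T : ℝ} (h0 : 0 < T) (h1 : T < 1) {q : ℂ} (hq : q = (T:ℂ)^2) :
    qp ((q^2)^2) ((q^2)^2) * (-(∑' n, 4 * gT T n) / qp q q - 2 * (∑' n, kT T (-1) n) / qp q q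
       - qp q q / qp (-q) q ^ 2 + 2 * (qp q q / qp (-(q^2)) (q^2))) = 
    4 * phip T * Thm T + 4 * phim T * Thp T - 8 * ∑' s : ℤ, pN T s * (1 - (T:ℂ)^(3*(8*s+2)))/(1 - (T:ℂ)^(4*(8*s+2))) := by
  obtain ⟨z, hz⟩ := IsAlgClosed.exists_pow_nat_eq (-1:ℂ) (n := 4) (by norm_num)
  have z0 : z ≠ 0 := by rintro rfl; norm_num at hz
  have hzi : z⁻¹^4 = -1 := by rw [inv_pow, hz]; norm_num
  have hzn : (-z)^4 = -1 := by rw [← hz]; ring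
  have hzm : (-z⁻¹)^4 = -1 := by rw [← hzi]; ring
  have H1 := bd4 h0 h1 hz
  have H2 := bd4 h0 h1 hzi
  have H3 := bd4 h0 h1 hzn
  have H4 := bd4 h0 h1 hzm
  have H0 := bdm h0 h1
  have s0 := star H0
  have s1 := star H1
  have s2 := star H2
  have s3 := star H3
  have s4 := star H4
  have b1 := beta_val H1 hz
  have b2 := beta_val H2 hzi
  have b3 := beta_val H3 hzn
  have b4 := beta_val H4 hzm
  have a0 := A_val H0
  have al := alpha_val h0 h1 hz
  have g := (G_val h0 h1 hz).tsum_eq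
  have y := Y_id h0 h1 hz
  have v1 := B1_val H0
  have v2 := sg1_val h0 h1
  have v3 := phip_val H0.t0 H0.t1
  have v4 := phim_val H0.t0 H0.t1
  have v5 := Thp_val H0.t0 H0.t1
  have hq1 := H0.q1
  rw [← B1_eq H0.t0] at s0
  rw [g]
  generalize (∑' s : ℤ, pN (T:ℂ) s * (1 - (T:ℂ)^(3*(8*s+2)))/(1 - (T:ℂ)^(4*(8*s+2)))) = W at *
  generalize (∑' s : ℤ, (z * (pN (T:ℂ) s / (1 + z^2 * (T:ℂ)^(8*s+2))) - pN (T:ℂ) s / (z^2 + (T:ℂ)^(8*s+2)))) = F1 at *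
  generalize (∑' s : ℤ, (z⁻¹ * (pN (T:ℂ) s / (1 + z⁻¹^2 * (T:ℂ)^(8*s+2))) - pN (T:ℂ) s / (z⁻¹^2 + (T:ℂ)^(8*s+2)))) = F2 at *
  generalize (∑' s : ℤ, (-z * (pN (T:ℂ) s / (1 + (-z)^2 * (T:ℂ)^(8*s+2))) - pN (T:ℂ) s / ((-z)^2 + (T:ℂ)^(8*s+2)))) = F3 at *
  generalize (∑' s : ℤ, (-z⁻¹ * (pN (T:ℂ) s / (1 + (-z⁻¹)^2 * (T:ℂ)^(8*s+2))) - pN (T:ℂ) s / ((-z⁻¹)^2 + (T:ℂ)^(8*s+2)))) = F4 at *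
  generalize (∑' s : ℤ, (-1 * (pN (T:ℂ) s / (1 + (-1)^2 * (T:ℂ)^(8*s+2))) - pN (T:ℂ) s / ((-1)^2 + (T:ℂ)^(8*s+2)))) = F0 at *
  generalize (∑' n : ℤ, aT z T n) = a1 at *
  generalize (∑' n : ℤ, aT z⁻¹ T n) = a2 at *
  generalize (∑' n : ℤ, aT (-z) T n) = a3 at *
  generalize (∑' n : ℤ, aT (-z⁻¹) T n) = a4 at *
  generalize (∑' n : ℤ, aT (-1) T n) = A0 at *
  generalize (∑' n : ℤ, kT T z n) = k1 at *
  generalize (∑' n : ℤ, kT T z⁻¹ n) = k2 at *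
  generalize (∑' n : ℤ, kT T (-z) n) = k3 at *
  generalize (∑' n : ℤ, kT T (-z⁻¹) n) = k4 at *
  generalize (∑' n : ℤ, kT T (-1) n) = K0 at *
  generalize B1 (T:ℂ) = B at *
  generalize sg (T:ℂ) 1 = sgm at *
  generalize phip (T:ℂ) = ph at *
  generalize phim (T:ℂ) = pm at *
  generalize Thm (T:ℂ) = th at *
  generalize Thp (T:ℂ) = tp at *
  generalize (∑' m : ℤ, aT (-(z^2*(T:ℂ)^2)) ((T:ℂ)^2) m) = be1 at *
  generalize (∑' m : ℤ, aT (-(z⁻¹^2*(T:ℂ)^2)) ((T:ℂ)^2) m) = be2 at *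
  generalize (∑' m : ℤ, aT (-((-z)^2*(T:ℂ)^2)) ((T:ℂ)^2) m) = be3 at *
  generalize (∑' m : ℤ, aT (-((-z⁻¹)^2*(T:ℂ)^2)) ((T:ℂ)^2) m) = be4 at *
  clear H0 H1 H2 H3 H4
  rw [← hq] at *
  rw [neg_one_mul, div_neg, div_one] at a0
  have hq2 := norm_sq_lt hq1
  have hq4 := norm_sq_lt hq2
  have E1n := qpq_ne hq1
  have E2n := qpq_ne hq2
  have E4n := qpq_ne hq4
  have f1 := pf1 hq1
  have f2 := pf2 hq1
  have f2' := pf2 hq2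
  have f3' := pf3 hq2
  have f5 := pf5 hq1
  rw [show -(q^2)^2 = -((q^2)^2) from rfl] at al
  generalize qp q q = E1 at *
  generalize qp (q^2) (q^2) = E2 at *
  generalize qp ((q^2)^2) ((q^2)^2) = E4 at *
  generalize qp (-q) (q^2) = M at *
  generalize qp q (q^2) = D at *
  generalize qp (-q) q = N at *
  generalize qp (-(q^2)) (q^2) = N2 at *
  generalize qp (-(q^2)) ((q^2)^2) = X at *
  generalize qp (-((q^2)^2)) ((q^2)^2) = Z at *
  have Mn : M ≠ 0 := by rintro rfl; rw [mul_zero] at f5; exact (pow_ne_zero 2 E2n) f5.symm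
  have Nn : N ≠ 0 := by rintro rfl; rw [mul_zero] at f2; exact E2n f2.symm
  have N2n : N2 ≠ 0 := by rintro rfl; rw [mul_zero] at f2'; exact E4n f2'.symm
  have Xn : X ≠ 0 := by rintro rfl; rw [zero_mul] at f3'; exact N2n f3'
  have Bn : B ≠ 0 := by rintro rfl; rw [zero_mul] at v1; exact (pow_ne_zero 2 E2n) v1.symm
  have e2 : be2 = be1 := mul_right_cancel₀ Xn (b2.trans b1.symm)
  have e3 : be3 = be1 := mul_right_cancel₀ Xn (b3.trans b1.symm)
  have e4 : be4 = be1 := mul_right_cancel₀ Xn (b4.trans b1.symm)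
  subst e2 e3 e4
  set G := ((1 - z⁻¹) * k1 + (1 - z) * k2 + (1 + z⁻¹) * k3 + (1 + z) * k4) with hG
  set aS := ((1 - z⁻¹) * a1 + (1 - z) * a2 + (1 + z⁻¹) * a3 + (1 + z) * a4) with haS
  have tot : aS * be4 + 2 * A0 * B = B * (G + 2 * K0) - 8 * sgm * W := by
    rw [hG, haS]
    linear_combination (1 - z⁻¹)*s1 + (1-z)*s2+(1+z⁻¹)*s3+(1+z)*s4 + 2*s0 + sgm * y
  clear_value G aS
  have p1 : sgm * E4 = B * E1 := by
    apply mul_right_cancel₀ Mn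
    apply mul_right_cancel₀ Mn
    linear_combination E4*M*v2 - E1*v1 + E1*f5
  have p2 : aS * be4 * E4 = -4 * ph * th * B * E1 := by
    rw [v3, ← f2', f3']
    linear_combination E2*be4*X*al - 4*E1*th*E2*b1 + 4*E1*th*E2*v1
  have p3 : 2 * A0 * N^2 = E1^2 := by linear_combination a0
  have p3' : 2 * A0 = E1 * (E1/N^2) := by field_simp; linear_combination p3
  have DN : D * N = 1 := by
    apply mul_right_cancel₀ E2n
    linear_combination f2 - N * f1
  have c1 : E1 / N^2 = E1 * D^2 := by
    field_simp; linear_combination (-(D*N+1))*DN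
  have c2 : E1 / N2 * E4 = E1 * E2 := by
    field_simp; linear_combination -f2'
  have p4 : E4 * (E1/N2) - E4 * (E1/N^2) = 2 * pm * tp := by
    rw [c1, v4]
    linear_combination c2 - D^2*E2*v5 - D*f5 + D*M*E4*f1 + E2*f1 - E4*D^2*f1
  have fin : E4 * (G + 2*K0) = E1 * (-4*ph*th + (E1/N^2)*E4 + 8*W) := by
    apply mul_left_cancel₀ Bn
    linear_combination (-E4)*tot + p2 + B*E4*p3' + 8*W*p1
  have l : E4 * (-G/E1 - 2*K0/E1 - E1/N^2 + 2*(E1/N2)) = -(E4*(G+2*K0))/E1 - E4*(E1/N^2) + 2 * (E4 * (E1/N2)) := by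
    ring
  rw [l, fin, neg_div, mul_div_cancel_left₀ _ E1n]
  linear_combination 2*p4

/-- weight of a multiset as partition -/
noncomputable def pw (q : ℂ) (f : Multiset ℕ → ℂ) (s : Multiset ℕ) : ℂ := if 0 ∈ s then 0 else f s * q ^ s.sum

/-- embedding of partitions into multisets -/
def pemb : (Σ n : ℕ, n.Partition) → Multiset ℕ := fun p => p.2.parts

theorem pemb_inj : Function.Injective pemb := by
  rintro ⟨n, p⟩ ⟨m, r⟩ h
  simp only [pemb] at h
  have : n = m := by rw [← p.parts_sum, ← r.parts_sum, h]
  subst this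
  congr 1
  exact Nat.Partition.ext h

theorem pemb_range (s : Multiset ℕ) (hs : 0 ∉ s) : s ∈ Set.range pemb :=
  ⟨⟨s.sum, ⟨s, fun hi => Nat.pos_of_ne_zero (fun h => hs (h ▸ hi)), rfl⟩⟩, rfl⟩

theorem pemb_zero (p : Σ n : ℕ, n.Partition) : 0 ∉ pemb p := fun h => (p.2.parts_pos h).ne' rfl

theorem pcard (n : ℕ) : Fintype.card n.Partition ≤ 2^n := by
  have := Fintype.card_le_of_surjective _ (Nat.Partition.ofComposition_surj (n := n))
  rw [composition_card] at this
  exact this.trans (Nat.pow_le_pow_right (by norm_num) (by omega))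

theorem psig_summ {r : ℝ} (h0 : 0 ≤ r) (h1 : r < 1/2) :
    Summable fun p : (Σ n : ℕ, n.Partition) => r ^ p.1 := by
  rw [summable_sigma_of_nonneg (fun _ => by positivity)]
  refine ⟨fun n => (hasSum_fintype _).summable, ?_⟩
  refine Summable.of_nonneg_of_le (fun n => tsum_nonneg fun _ => by positivity) (fun n => ?_)
    (summable_geometric_of_lt_one (r := 2*r) (by positivity) (by linarith))
  rw [tsum_fintype]
  simp only []
  rw [Finset.sum_const, nsmul_eq_mul, mul_pow]
  refine mul_le_mul_of_nonneg_right ?_ (by positivity)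
  have := pcard n
  rw [Finset.card_univ]
  exact_mod_cast this

theorem pw_norm {q : ℂ} (hq : ‖q‖ < 1/2) {f : Multiset ℕ → ℂ} {C : ℝ} (hf : ∀ s, ‖f s‖ ≤ C) :
    Summable fun s => ‖pw q f s‖ := by
  rw [← pemb_inj.summable_iff]
  · refine Summable.of_nonneg_of_le (fun _ => norm_nonneg _) (fun p => ?_) ((psig_summ (norm_nonneg q) hq).mul_left C)
    simp only [Function.comp, pw]
    rw [if_neg (pemb_zero p), norm_mul, norm_pow]
    have : (pemb p).sum = p.1 := p.2.parts_sum
    rw [this]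
    exact mul_le_mul_of_nonneg_right (hf _) (by positivity)
  · intro s hs
    have : 0 ∈ s := by by_contra h; exact hs (pemb_range s h)
    simp [pw, this]

theorem pw_gf {q : ℂ} (hq : ‖q‖ < 1/2) {f : Multiset ℕ → ℂ} {C : ℝ} (hf : ∀ s, ‖f s‖ ≤ C) :
    HasSum (fun n : ℕ => (∑ p : n.Partition, f p.parts) * q^n) (∑' s, pw q f s) := by
  have h := (pw_norm hq hf).of_norm.hasSum
  rw [← pemb_inj.hasSum_iff] at h
  · refine (h.sigma (fun n => hasSum_fintype _)).cg (fun n => ?_) rfl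
    rw [Finset.sum_mul]
    refine Finset.sum_congr rfl fun p _ => ?_
    simp only [Function.comp, pw]
    rw [if_neg (pemb_zero _)]
    congr 2
    exact p.parts_sum.symm
  · intro s hs
    have : 0 ∈ s := by by_contra h; exact hs (pemb_range s h)
    simp [pw, this]

/-- multiplicative weights with all parts > k -/
noncomputable def fk (q : ℂ) (c : ℕ → ℂ) (k : ℕ) (s : Multiset ℕ) : ℂ :=
  if ∀ i ∈ s, k < i then (s.map c).prod * q ^ s.sum else 0

theorem prod_norm_le {c : ℕ → ℂ} (hc : ∀ i, ‖c i‖ ≤ 1) (s : Multiset ℕ) : ‖(s.map c).prod‖ ≤ 1 := by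
  induction s using Multiset.induction with
  | empty => simp
  | cons a s ih =>
    rw [Multiset.map_cons, Multiset.prod_cons, norm_mul]
    exact mul_le_one₀ (hc a) (norm_nonneg _) ih

theorem fk_le {q : ℂ} {c : ℕ → ℂ} (hc : ∀ i, ‖c i‖ ≤ 1) (k : ℕ) (s : Multiset ℕ) :
    ‖fk q c k s‖ ≤ ‖pw q (fun _ => 1) s‖ := by
  rw [fk, pw]
  split_ifs with h h0 h0
  · exact absurd (h 0 h0) (by simp)
  · rw [norm_mul, norm_mul, norm_one]
    exact mul_le_mul_of_nonneg_right (prod_norm_le hc s) (norm_nonneg _)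
  · simp
  · rw [norm_zero]; exact norm_nonneg _

theorem fk_norm {q : ℂ} (hq : ‖q‖ < 1/2) {c : ℕ → ℂ} (hc : ∀ i, ‖c i‖ ≤ 1) (k : ℕ) :
    Summable fun s => ‖fk q c k s‖ :=
  Summable.of_nonneg_of_le (fun _ => norm_nonneg _) (fk_le hc k) (pw_norm (C := 1) hq (fun _ => by simp))

/-- generating function -/
noncomputable def Fk (q : ℂ) (c : ℕ → ℂ) (k : ℕ) : ℂ := ∑' s, fk q c k s

theorem cons_inj (a : ℕ) : Function.Injective (fun s : Multiset ℕ => a ::ₘ s) := fun s t h => by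
  simpa using h

theorem tsum_cons (a : ℕ) (f : Multiset ℕ → ℂ) (hf : ∀ s, a ∉ s → f s = 0) :
    ∑' s, f (a ::ₘ s) = ∑' s, f s := by
  refine (cons_inj a).tsum_eq (f := f) ?_
  intro s hs
  by_contra h
  apply hs
  apply hf
  intro ha
  exact h ⟨s.erase a, Multiset.cons_erase ha⟩

theorem Fk_rec {q : ℂ} (hq : ‖q‖ < 1/2) {c : ℕ → ℂ} (hc : ∀ i, ‖c i‖ ≤ 1) (k : ℕ) :
    Fk q c k * (1 - c (k+1) * q^(k+1)) = Fk q c (k+1) := by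
  have e : ∀ s, fk q c k s = fk q c (k+1) s + (if k+1 ∈ s then fk q c k s else 0) := by
    intro s
    by_cases h : k+1 ∈ s
    · rw [if_pos h, fk, fk, if_neg (c := ∀ i ∈ s, k+1 < i), zero_add]
      intro h'; exact absurd (h' _ h) (by simp)
    · rw [if_neg h, fk, fk, add_zero]
      have : (∀ i ∈ s, k < i) ↔ (∀ i ∈ s, k+1 < i) := by
        refine forall₂_congr fun i hi => ?_
        have : i ≠ k+1 := fun h' => h (h' ▸ hi)
        omega
      simp only [this]
  have s1 := (fk_norm hq hc (k+1)).of_norm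
  have s0 := (fk_norm hq hc k).of_norm
  have s2 : Summable (fun s => if k+1 ∈ s then fk q c k s else 0) := by
    refine (s0.sub s1).congr fun s => ?_
    have := e s
    linear_combination this
  have t : ∑' s, (if k+1 ∈ s then fk q c k s else 0) = c (k+1) * q^(k+1) * Fk q c k := by
    rw [← tsum_cons (k+1) _ (fun s hs => by rw [if_neg hs]), Fk, ← tsum_mul_left]
    refine tsum_congr fun s => ?_
    rw [if_pos (Multiset.mem_cons_self _ _), fk, fk]
    simp only [Multiset.forall_mem_cons, Multiset.map_cons, Multiset.prod_cons, Multiset.sum_cons, lt_add_one, true_and]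
    split_ifs
    · rw [pow_add]; ring
    · ring
  have : Fk q c k = Fk q c (k+1) + c (k+1) * q^(k+1) * Fk q c k := by
    conv_lhs => rw [Fk, tsum_congr e, s1.tsum_add s2, t]
    rfl
  linear_combination this

theorem Fk_lim {q : ℂ} (hq : ‖q‖ < 1/2) {c : ℕ → ℂ} (hc : ∀ i, ‖c i‖ ≤ 1) :
    Tendsto (Fk q c) atTop (𝓝 1) := by
  have h := tendsto_tsum_of_dominated_convergence (𝓕 := atTop) (f := fun k s => fk q c k s)
    (g := fun s => if s = 0 then 1 else 0) (pw_norm (C := 1) hq (f := fun _ => 1) (fun _ => by simp)) ?_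
    (Eventually.of_forall fun k s => fk_le hc k s)
  · rw [tsum_ite_eq] at h
    exact h
  · intro s
    by_cases hs : s = 0
    · subst hs; simp [fk]
    · rw [if_neg hs]
      refine tendsto_const_nhds.congr' ?_
      obtain ⟨a, ha⟩ := Multiset.exists_mem_of_ne_zero hs
      filter_upwards [eventually_ge_atTop a] with k hk
      rw [fk, if_neg]
      intro h
      exact absurd (h a ha) (by omega)

theorem fac_ne {q x : ℂ} (hq : ‖q‖ < 1/2) (hx : ‖x‖ ≤ 1) (k : ℕ) : 1 - x * q^(k+1) ≠ 0 := by
  intro h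
  have h2 : ‖x * q^(k+1)‖ = 1 := by rw [← sub_eq_zero.1 h]; simp
  rw [norm_mul, norm_pow] at h2
  have h3 : ‖q‖^(k+1) < 1 := pow_lt_one₀ (norm_nonneg _) (by linarith) (by omega)
  nlinarith [norm_nonneg x, pow_nonneg (norm_nonneg q) (k+1)]

/-- V_0 -/
theorem Fk_const {q z : ℂ} (hq : ‖q‖ < 1/2) (hz : ‖z‖ ≤ 1) :
    Fk q (fun _ => z) 0 * qp (z*q) q = 1 ∧ ∀ k, Fk q (fun _ => z) k = Fk q (fun _ => z) 0 * qf (z*q) q k := by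
  have hr : ∀ k, Fk q (fun _ => z) k = Fk q (fun _ => z) 0 * qf (z*q) q k := by
    intro k
    induction k with
    | zero => simp [qf_zero]
    | succ k ih =>
      rw [← Fk_rec hq (fun _ => hz), ih, qf_succ, pow_succ]; ring
  refine ⟨?_, hr⟩
  have l1 := Fk_lim hq (c := fun _ => z) (fun _ => hz)
  have l2 := (qf_tendsto (a := z*q) (q := q) (by linarith)).const_mul (Fk q (fun _ => z) 0)
  exact tendsto_nhds_unique l2 (l1.congr hr)

/-- coefficient of the q-binomial series -/
noncomputable def qb (a q : ℂ) (n : ℕ) : ℂ := qf a q n / qf q q n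

theorem qb_bound (a : ℂ) {q : ℂ} (h1 : ‖q‖ < 1) : ∃ M : ℝ, ∀ n, ‖qb a q n‖ ≤ M := by
  have l : Tendsto (qb a q) atTop (𝓝 (qp a q / qp q q)) :=
    (qf_tendsto a h1).div (qf_tendsto q h1) (qpq_ne h1)
  obtain ⟨M, hM⟩ := (Metric.isBounded_range_of_tendsto _ l).exists_norm_le
  exact ⟨M, fun n => hM _ ⟨n, rfl⟩⟩

theorem qb_norm (a : ℂ) {q x : ℂ} (h1 : ‖q‖ < 1) (hx : ‖x‖ < 1) : Summable fun n => ‖qb a q n * x^n‖ := by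
  obtain ⟨M, hM⟩ := qb_bound a h1
  refine Summable.of_nonneg_of_le (fun _ => norm_nonneg _) (fun n => ?_)
    ((summable_geometric_of_lt_one (norm_nonneg x) hx).mul_left M)
  rw [norm_mul, norm_pow]
  exact mul_le_mul_of_nonneg_right (hM n) (by positivity)

theorem qb_succ (a : ℂ) {q : ℂ} (h1 : ‖q‖ < 1) (n : ℕ) : 
    qb a q (n+1) * (1 - q^(n+1)) = qb a q n * (1 - a*q^n) := by
  have h := qfq_ne h1 n
  have h2 := qfq_ne h1 (n+1)
  rw [qb, qb, qf_succ, qf_succ]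
  rw [qf_succ] at h2
  have h3 : 1 - q*q^n ≠ 0 := right_ne_zero_of_mul h2
  rw [pow_succ', div_mul_eq_mul_div, div_mul_eq_mul_div, div_eq_div_iff h2 h]
  ring

theorem qb_fe (a : ℂ) {q x : ℂ} (h1 : ‖q‖ < 1) (hx : ‖x‖ < 1) :
    (1 - x) * ∑' n, qb a q n * x^n = (1 - a*x) * ∑' n, qb a q n * (x*q)^n := by
  have hxq : ‖x*q‖ < 1 := by rw [norm_mul]; nlinarith [norm_nonneg x, norm_nonneg q]
  have s1 := (qb_norm a h1 hx).of_norm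
  have s2 := (qb_norm a h1 hxq).of_norm
  have e1 : (∑' n, qb a q n * x^n) - (∑' n, qb a q n * (x*q)^n) = x * ((∑' n, qb a q n * x^n) - a * ∑' n, qb a q n * (x*q)^n) := by
    rw [← tsum_mul_left (a := a), ← s1.tsum_sub (s2.mul_left a), ← s1.tsum_sub s2, (s1.sub s2).tsum_eq_zero_add, ← tsum_mul_left]
    simp only [pow_zero, sub_self, zero_add]
    refine tsum_congr fun n => ?_
    have := qb_succ a h1 n
    rw [mul_pow, mul_pow, pow_succ x]
    linear_combination x^n * x * this
  linear_combination e1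

theorem qbinom (a : ℂ) {q x : ℂ} (h1 : ‖q‖ < 1) (hx : ‖x‖ < 1) :
    qp x q * ∑' n, qb a q n * x^n = qp (a*x) q := by
  have hxn : ∀ N, ‖x * q^N‖ ≤ ‖x‖ := fun N => by
    rw [norm_mul, norm_pow]
    exact mul_le_of_le_one_right (norm_nonneg _) (pow_le_one₀ (norm_nonneg _) h1.le)
  have it : ∀ N, qf x q N * ∑' n, qb a q n * x^n = qf (a*x) q N * ∑' n, qb a q n * (x*q^N)^n := by
    intro N
    induction N with
    | zero => simp [qf_zero]
    | succ N ih =>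
      have := qb_fe a h1 ((hxn N).trans_lt hx)
      rw [qf_succ, qf_succ, pow_succ, ← mul_assoc x]
      linear_combination (1 - x * q^N) * ih + qf (a*x) q N * this
  have l0 : Tendsto (fun N => ∑' n, qb a q n * (x*q^N)^n) atTop (𝓝 (∑' n, if n = 0 then 1 else 0)) := by
    refine tendsto_tsum_of_dominated_convergence (qb_norm a h1 hx) (fun n => ?_) (Eventually.of_forall fun N n => ?_)
    · rcases Nat.eq_zero_or_pos n with rfl | hn
      · simp [qb, qf_zero]
      · rw [if_neg hn.ne']
        have := ((((tendsto_pow_atTop_nhds_zero_of_norm_lt_one h1).const_mul x).pow n).const_mul (qb a q n))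
        simpa [hn.ne'] using this
    · rw [norm_mul, norm_mul, norm_pow, norm_pow]
      exact mul_le_mul_of_nonneg_left (pow_le_pow_left₀ (norm_nonneg _) (hxn N) n) (norm_nonneg _)
  rw [tsum_ite_eq] at l0
  have l1 := (qf_tendsto x h1).mul_const (∑' n, qb a q n * x^n)
  have l2 := (qf_tendsto (a*x) h1).mul l0
  rw [mul_one] at l2
  exact tendsto_nhds_unique l1 (l2.congr fun N => (it N).symm)

theorem tsum_fib {α : Type*} {f : α → ℂ} (hf : Summable f) {β : Type*} [DecidableEq β] (g : α → β) :
    HasSum (fun n => ∑' s, if g s = n then f s else 0) (∑' s, f s) := by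
  classical
  refine (hf.hasSum.tsum_fiberwise g).cg (fun n => ?_) rfl
  rw [tsum_subtype]
  refine tsum_congr fun s => ?_
  rw [Set.indicator_apply]
  by_cases h : g s = n
  · rw [if_pos h, if_pos (show s ∈ g ⁻¹' {n} from h)]
  · rw [if_neg h, if_neg (show s ∉ g ⁻¹' {n} from h)]

theorem summ_ite {α : Type*} {f : α → ℂ} (hf : Summable f) (p : α → Prop) [DecidablePred p] :
    Summable fun s => if p s then f s else 0 := by
  refine (hf.indicator {s | p s}).congr fun s => ?_
  rw [Set.indicator_apply]
  rfl

/-- crank on multisets -/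
def mcr (s : Multiset ℕ) : ℤ :=
  if s.count 1 = 0 then (s.sup : ℤ)
  else ((s.filter (fun x => s.count 1 < x)).card : ℤ) - s.count 1

/-- chain for weights equal to one up to m -/
theorem Fk_chain {q : ℂ} (hq : ‖q‖ < 1/2) {c : ℕ → ℂ} (hc : ∀ i, ‖c i‖ ≤ 1) (m : ℕ) (h : ∀ i, i ≤ m → c i = 1)
    (n : ℕ) (hn : n + 1 ≤ m) : Fk q c 1 * qf q q (n+1) = (1 - q) * Fk q c (n+1) := by
  induction n with
  | zero => rw [qf_succ, qf_zero]; ring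
  | succ n ih =>
    rw [← Fk_rec hq hc (n+1), h _ hn, qf_succ, pow_succ' q (n+1)]
    linear_combination (1 - q * q^(n+1)) * ih (by omega)

theorem Fk_top {q : ℂ} (m : ℕ) : Fk q (fun i => if i ≤ m then 1 else 0) m = 1 := by
  rw [Fk, tsum_eq_single 0]
  · simp [fk]
  · intro s hs
    obtain ⟨a, ha⟩ := Multiset.exists_mem_of_ne_zero hs
    rw [fk]
    split_ifs with h
    · rw [Multiset.prod_eq_zero, zero_mul]
      exact Multiset.mem_map.2 ⟨a, ha, if_neg (by have := h a ha; omega)⟩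
    · rfl

theorem Fk_topz {q z : ℂ} (m : ℕ) : Fk q (fun i => if m < i then z else 1) m = Fk q (fun _ => z) m := by
  rw [Fk, Fk]
  refine tsum_congr fun s => ?_
  rw [fk, fk]
  split_ifs with h
  · congr 2
    exact Multiset.map_congr rfl fun i hi => if_pos (h i hi)
  · rfl

theorem map_ite_prod (z : ℂ) (m : ℕ) (s : Multiset ℕ) : 
    (s.map (fun i => if m < i then z else 1)).prod = z ^ (s.filter (fun x => m < x)).card := by
  induction s using Multiset.induction with
  | empty => simp
  | cons a s ih =>
    rw [Multiset.map_cons, Multiset.prod_cons, ih]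
    by_cases h : m < a
    · rw [if_pos h, Multiset.filter_cons_of_pos _ h, Multiset.card_cons, pow_succ']
    · rw [if_neg h, Multiset.filter_cons_of_neg _ h, one_mul]

theorem map_ite_prod0 (m : ℕ) (s : Multiset ℕ) : 
    (s.map (fun i => if i ≤ m then (1:ℂ) else 0)).prod = if s.sup ≤ m then 1 else 0 := by
  induction s using Multiset.induction with
  | empty => simp
  | cons a s ih =>
    rw [Multiset.map_cons, Multiset.prod_cons, ih, Multiset.sup_cons]
    by_cases h : a ≤ m <;> by_cases h2 : s.sup ≤ m <;> simp [h, h2]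

theorem crank_pos {q z : ℂ} (hz : z ≠ 0) (v : ℕ) (hv : v ≠ 0) :
    ∑' s : Multiset ℕ, (if s.count 1 = v then pw q (fun s => z ^ mcr s) s else 0) =
      z⁻¹ ^ v * q^v * Fk q (fun i => if v < i then z else 1) 1 := by
  have inj : Function.Injective fun s : Multiset ℕ => s + Multiset.replicate v 1 := fun a b h => by
    simpa using h
  rw [← inj.tsum_eq, Fk, ← tsum_mul_left]
  · refine tsum_congr fun s => ?_
    rw [Multiset.count_add, Multiset.count_replicate_self, fk, pw]
    by_cases h : ∀ i ∈ s, 1 < i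
    · have h1 : s.count 1 = 0 := Multiset.count_eq_zero.2 fun h' => absurd (h _ h') (by simp)
      have h0 : 0 ∉ s + Multiset.replicate v 1 := by
        rw [Multiset.mem_add, Multiset.mem_replicate]
        rintro (h' | h')
        · exact absurd (h _ h') (by simp)
        · omega
      rw [if_pos (by omega), if_neg h0, if_pos h, map_ite_prod]
      have : mcr (s + Multiset.replicate v 1) = ((s.filter (fun x => v < x)).card : ℤ) - v := by
        have h9 : (Multiset.replicate v 1).filter (fun x => v < x) = 0 := by
          rw [Multiset.filter_eq_nil]
          intro a ha
          rw [Multiset.mem_replicate] at ha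
          omega
        rw [mcr, Multiset.count_add, Multiset.count_replicate_self, h1, zero_add, if_neg hv, Multiset.filter_add,
          h9, add_zero]
      rw [this, zpow_sub₀ hz, Multiset.sum_add, Multiset.sum_replicate, pow_add, smul_eq_mul, mul_one, zpow_natCast, zpow_natCast, inv_pow]
      field_simp
    · rw [if_neg h, mul_zero]
      push Not at h
      obtain ⟨i, hi, hi1⟩ := h
      split_ifs with h1 h2 <;> try rfl
      exfalso
      have : 1 ∉ s := by rw [← Multiset.count_eq_zero]; omega
      apply h2
      rw [Multiset.mem_add]; left
      have : i ≠ 1 := fun h => this (h ▸ hi)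
      rwa [show i = 0 by omega] at hi
  · intro s hs
    have : s.count 1 = v := by by_contra h; exact hs (if_neg h)
    refine ⟨s - Multiset.replicate v 1, ?_⟩
    exact Multiset.sub_add_cancel (Multiset.le_count_iff_replicate_le.1 this.ge)

theorem sup_mem {s : Multiset ℕ} (hs : s ≠ 0) : s.sup ∈ s := by
  induction s using Multiset.induction with
  | empty => exact absurd rfl hs
  | cons a s ih =>
    rw [Multiset.sup_cons]
    rcases eq_or_ne s 0 with rfl | h
    · simp
    · rcases le_total a s.sup with h2 | h2
      · rw [max_eq_right h2]
        exact Multiset.mem_cons_of_mem (ih h)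
      · rw [max_eq_left h2]
        exact Multiset.mem_cons_self _ _

theorem crank_sup {q z : ℂ} (m : ℕ) (hm : 2 ≤ m) :
    ∑' s : Multiset ℕ, (if s.sup = m then (if s.count 1 = 0 then pw q (fun s => z ^ mcr s) s else 0) else 0) =
      z ^ m * q^m * Fk q (fun i => if i ≤ m then 1 else 0) 1 := by
  rw [← tsum_cons m, Fk, ← tsum_mul_left]
  · refine tsum_congr fun s => ?_
    rw [Multiset.sup_cons, Multiset.count_cons_of_ne (by omega), fk, map_ite_prod0, pw, mcr, 
      Multiset.count_cons_of_ne (by omega), Multiset.sup_cons, Multiset.sum_cons]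
    have e : (∀ i ∈ s, 1 < i) ↔ (s.count 1 = 0 ∧ 0 ∉ s) := by
      rw [Multiset.count_eq_zero]
      constructor
      · intro h
        exact ⟨fun h' => absurd (h _ h') (by simp), fun h' => absurd (h _ h') (by simp)⟩
      · rintro ⟨h1, h2⟩ i hi
        have : i ≠ 1 := fun h => h1 (h ▸ hi)
        have : i ≠ 0 := fun h => h2 (h ▸ hi)
        omega
    have m0 : ¬ (0 = m) := by omega
    by_cases h1 : s.count 1 = 0 <;> by_cases h2 : 0 ∈ s <;> by_cases h3 : s.sup ≤ m <;> simp [e, h1, h2, h3, m0, pow_add]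
    all_goals ring
  · intro s hs
    split_ifs with h1 h2 <;> try rfl
    exfalso
    apply hs
    rw [← h1]
    refine sup_mem ?_
    rintro rfl
    simp at h1
    omega



theorem zpow_norm_one {z : ℂ} (hz : ‖z‖ = 1) (n : ℤ) : ‖z ^ n‖ = 1 := by rw [norm_zpow, hz, one_zpow]

theorem crank_zero {q z : ℂ} (hq : ‖q‖ < 1/2) (hz : ‖z‖ = 1) :
    ∑' s : Multiset ℕ, (if s.count 1 = 0 then pw q (fun s => z ^ mcr s) s else 0) =
      (1 - q) * Fk q (fun _ => z) 0 + q - z * q := by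
  have h1 : ‖q‖ < 1 := by linarith
  have hzq : ‖z*q‖ < 1 := by rw [norm_mul, hz, one_mul]; exact h1
  have sm : Summable fun s => pw q (fun s => z ^ mcr s) s :=
    (pw_norm (C := 1) hq (fun s => (zpow_norm_one hz _).le)).of_norm
  have sm0 : Summable fun s : Multiset ℕ => (if s.count 1 = 0 then pw q (fun s => z ^ mcr s) s else 0) :=
    summ_ite sm _
  have key := tsum_fib sm0 (fun s => s.sup)
  have V := (Fk_const (z := z) hq hz.le).1
  have hb := qbinom 0 h1 hzq
  have q1 : (1 - q) ≠ 0 := by simpa using one_sub_pow_ne h1 0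
  have q0 : ∀ n, qf 0 q n = 1 := fun n => by simp [qf]
  have qp0 : qp (0 * (z*q)) q = 1 := by simp [qp]
  rw [qp0] at hb
  have s1 := ((qb_norm 0 h1 hzq).of_norm.hasSum.mul_left (1-q)).add
    ((hasSum_ite_eq (0:ℕ) q).add (hasSum_ite_eq (1:ℕ) (-(z*q))))
  have e := (key.cg (g := fun n => (1-q) * (qb 0 q n * (z*q)^n) + ((if n = 0 then q else 0) + (if n = 1 then -(z*q) else 0)))
    (fun n => ?_) rfl).unique s1
  · rw [e]
    linear_combination ((1 - q) * Fk q (fun _ => z) 0) * hb - (1-q) * (∑' n, qb 0 q n * (z*q)^n) * V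
  · symm
    rcases Nat.lt_or_ge n 2 with hn | hn
    · interval_cases n
      · rw [tsum_eq_single 0]
        · simp [pw, mcr, qb, qf_zero]
        · intro s hs
          split_ifs with h1 h2 <;> try rfl
          rw [pw, if_pos]
          rw [← h1]; exact sup_mem hs
      · rw [tsum_eq_single 0]
        · simp [qb, q0, qf_succ, qf_zero]
          field_simp
          ring
        · intro s hs
          split_ifs with h1 h2 <;> try rfl
          have := sup_mem hs
          rw [h1] at this
          rw [Multiset.count_eq_zero] at h2
          exact absurd this h2
    · rw [crank_sup n hn, if_neg (by omega), if_neg (by omega)]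
      obtain ⟨k, rfl⟩ : ∃ k, n = k + 1 := ⟨n - 1, by omega⟩
      have f1 := Fk_chain hq (c := fun i => if i ≤ k+1 then 1 else 0) (fun i => by split_ifs <;> simp) (k+1)
        (fun i hi => if_pos hi) k le_rfl
      rw [Fk_top] at f1
      rw [qb, q0]
      have := qfq_ne h1 (k+1)
      rw [mul_pow]
      generalize z^(k+1) = Z
      generalize q^(k+1) = Q
      generalize qf (z*q) q (k+1) = A at *
      field_simp
      linear_combination Z * Q * f1

theorem crank_gf {q z : ℂ} (hq : ‖q‖ < 1/2) (hz : ‖z‖ = 1) :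
    ∑' s : Multiset ℕ, pw q (fun s => z ^ mcr s) s = (1 - z) * q + qp q q / (qp (z*q) q * qp (z⁻¹*q) q) := by
  have h1 : ‖q‖ < 1 := by linarith
  have z0 : z ≠ 0 := by rintro rfl; simp at hz
  have hzi : ‖z⁻¹‖ = 1 := by rw [norm_inv, hz, inv_one]
  have hzq : ‖z⁻¹*q‖ < 1 := by rw [norm_mul, hzi, one_mul]; exact h1
  have sm : Summable fun s => pw q (fun s => z ^ mcr s) s :=
    (pw_norm (C := 1) hq (fun s => (zpow_norm_one hz _).le)).of_norm
  have key := tsum_fib sm (fun s => s.count 1)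
  obtain ⟨V, Vk⟩ := (Fk_const (z := z) hq hz.le)
  have Vi := left_ne_zero_of_mul_eq_one (Fk_const (z := z⁻¹) hq hzi.le).1
  have hb := qbinom (z*q) h1 hzq
  set V0 := Fk q (fun _ => z) 0 with hV0
  have s1 := ((qb_norm (z*q) h1 hzq).of_norm.hasSum.mul_left ((1-q) * V0)).add
    (hasSum_ite_eq (0:ℕ) (q - z * q))
  have e := (key.cg (g := fun n => (1-q) * V0 * (qb (z*q) q n * (z⁻¹*q)^n) + (if n = 0 then (q - z * q) else 0))
    (fun n => ?_) rfl).unique s1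
  · rw [e]
    have n1 : qp (z*q) q ≠ 0 := right_ne_zero_of_mul_eq_one V
    have n2 : qp (z⁻¹*q) q ≠ 0 := right_ne_zero_of_mul_eq_one (Fk_const (z := z⁻¹) hq hzi.le).1
    have r := qp_rec q h1
    have : z * q * (z⁻¹ * q) = q*q := by field_simp
    rw [this] at hb
    rw [eq_div_of_mul_eq n1 V, r, ← hb]
    generalize (∑' n, qb (z * q) q n * (z⁻¹ * q) ^ n) = S at *
    generalize qp (z*q) q = A at *
    generalize qp (z⁻¹*q) q = B at *
    field_simp
    ring
  · symm
    rcases Nat.eq_zero_or_pos n with rfl | hn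
    · rw [crank_zero hq hz]
      simp [qb, qf_zero]
      ring
    · rw [crank_pos z0 n hn.ne', if_neg hn.ne']
      obtain ⟨k, rfl⟩ : ∃ k, n = k + 1 := ⟨n - 1, by omega⟩
      have f1 := Fk_chain hq (c := fun i => if k+1 < i then z else 1) (fun i => by split_ifs <;> simp [hz]) (k+1)
        (fun i hi => if_neg (by omega)) k le_rfl
      rw [Fk_topz, Vk] at f1
      rw [qb]
      have := qfq_ne h1 (k+1)
      rw [mul_pow]
      generalize z⁻¹^(k+1) = Z
      generalize q^(k+1) = Q
      generalize qf (z*q) q (k+1) = A at *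
      field_simp
      linear_combination Z * Q * f1

theorem zper {w : ℂ} (hw : w^8 = 1) (k : ℤ) (r : ℕ) : w ^ (8*k + (r:ℤ)) = w^r := by
  have w0 : w ≠ 0 := by rintro rfl; norm_num at hw
  rw [zpow_add₀ w0, zpow_mul, show w^(8:ℤ) = w^8 by norm_cast, hw, one_zpow, one_mul, zpow_natCast]

theorem ind8 {z : ℂ} (hz : z^4 = -1) (m : ℤ) :
    8 * (if m % 8 = 2 then (1:ℂ) else 0) = 1^m + (-1)^m - (z^2)^m - (-z^2)^m
      + (-z^2) * (z^m + (-z)^m - (-z^3)^m - (z^3)^m) := by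
  obtain ⟨k, r, hr, rfl⟩ : ∃ (k : ℤ) (r : ℕ), r < 8 ∧ m = 8*k + (r:ℤ) := ⟨m / 8, (m % 8).toNat, by omega, by omega⟩
  have h8 : z^8 = 1 := by rw [show (8:ℕ) = 4*2 by norm_num, pow_mul, hz]; norm_num
  rw [zper (by norm_num), zper (by norm_num), zper (by grind), zper (by grind), zper h8, zper (by grind), zper (by grind), zper (by grind)]
  have : (8*k + (r:ℤ)) % 8 = 2 ↔ r = 2 := by omega
  simp only [this]
  interval_cases r <;> simp <;> grind

theorem crank8 {q z : ℂ} (hq : ‖q‖ < 1/2) (hz : z^4 = -1) :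
    8 * ∑' s : Multiset ℕ, pw q (fun s => if mcr s % 8 = 2 then 1 else 0) s =
      1 / qp q q + qp q q / qp (-q) q ^ 2 - 2 * (qp q q / qp (-(q^2)) (q^2)) := by
  have h1 : ‖q‖ < 1 := by linarith
  have nz : ‖z‖ = 1 := by
    have : ‖z‖^4 = 1 := by rw [← norm_pow, hz]; simp
    exact (pow_eq_one_iff_of_nonneg (norm_nonneg _) (by norm_num)).1 this
  have sm : ∀ w : ℂ, ‖w‖ = 1 → Summable fun s => pw q (fun s => w ^ mcr s) s := fun w hw =>
    (pw_norm (C := 1) hq (fun s => (zpow_norm_one hw _).le)).of_norm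
  have n1 : ‖(1:ℂ)‖ = 1 := by simp
  have n2 : ‖(-1:ℂ)‖ = 1 := by simp
  have n3 : ‖z^2‖ = 1 := by simp [nz]
  have n4 : ‖-z^2‖ = 1 := by simp [nz]
  have n6 : ‖-z‖ = 1 := by simp [nz]
  have n7 : ‖-z^3‖ = 1 := by simp [nz]
  have n8 : ‖z^3‖ = 1 := by simp [nz]
  have H := ((((sm _ n1).hasSum.add (sm _ n2).hasSum).sub (sm _ n3).hasSum).sub (sm _ n4).hasSum).add
    (((((sm _ nz).hasSum.add (sm _ n6).hasSum).sub (sm _ n7).hasSum).sub (sm _ n8).hasSum).mul_left (-z^2))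
  rw [crank_gf hq n1, crank_gf hq n2, crank_gf hq n3, crank_gf hq n4, crank_gf hq nz, crank_gf hq n6, crank_gf hq n7,
    crank_gf hq n8] at H
  have z0 : z ≠ 0 := by rintro rfl; simp at nz
  have i1 : z⁻¹ = -z^3 := inv_eq_of_mul_eq_one_right (by linear_combination -hz)
  have i2 : (-z)⁻¹ = z^3 := by rw [inv_neg, i1]; ring
  have i3 : (z^2)⁻¹ = -z^2 := inv_eq_of_mul_eq_one_right (by linear_combination -hz)
  have i4 : (-z^2)⁻¹ = z^2 := by rw [inv_neg, i3]; ring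
  have i5 : (-z^3)⁻¹ = z := by rw [← i1, inv_inv]
  have i6 : (z^3)⁻¹ = -z := by rw [← i2, inv_inv]
  have i7 : (-1:ℂ)⁻¹ = -1 := by norm_num
  rw [i1, i2, i3, i4, i5, i6, i7, inv_one, one_mul, neg_one_mul] at H
  have m1 : qp (z^2*q) q * qp (-z^2*q) q = qp (-(q^2)) (q^2) := by
    rw [neg_mul, qp_mul_neg _ h1]
    congr 1
    rw [mul_pow]; linear_combination q^2 * hz
  rw [mul_comm (qp (-z^2*q) q), m1, mul_comm (qp (-z^3*q) q), mul_comm (qp (z^3*q) q)] at H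
  rw [← tsum_mul_left]
  refine (H.cg (fun s => ?_) ?_).tsum_eq
  · simp only [pw]
    split_ifs with h h2
    · ring
    · have := ind8 hz (mcr s)
      rw [if_pos h2] at this
      linear_combination q^s.sum * this
    · have := ind8 hz (mcr s)
      rw [if_neg h2] at this
      linear_combination q^s.sum * this
  · have := qpq_ne h1
    generalize qp (z*q) q * qp (-z^3*q) q = A
    generalize qp (-z*q) q * qp (z^3*q) q = B
    have e : qp q q / (qp q q * qp q q) = 1 / qp q q := by field_simp
    rw [e]
    ring

/-- remove the first column -/
def Dm (s : Multiset ℕ) : Multiset ℕ := (s.map Nat.pred).filter (fun x => x ≠ 0)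

theorem Dm_add (s : Multiset ℕ) (hs : 0 ∉ s) : (Dm s).map Nat.succ + Multiset.replicate (s.count 1) 1 = s := by
  induction s using Multiset.induction with
  | empty => simp [Dm]
  | cons a s ih =>
    rw [Multiset.mem_cons, not_or] at hs
    have ih := ih hs.2
    rw [Dm, Multiset.map_cons]
    by_cases h : a = 1
    · subst h
      rw [Multiset.filter_cons_of_neg _ (by simp), Multiset.count_cons_self, Multiset.replicate_succ, Multiset.add_cons]
      exact congrArg _ ih
    · rw [Multiset.filter_cons_of_pos _ (by simp; omega), Multiset.count_cons_of_ne (by omega), Multiset.map_cons,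
        Multiset.cons_add, Nat.succ_pred_eq_of_pos (by omega)]
      exact congrArg _ ih

theorem Dm_zero (s : Multiset ℕ) : 0 ∉ Dm s := by simp [Dm]

theorem Dm_succ (t : Multiset ℕ) (ht : 0 ∉ t) (j : ℕ) : Dm (t.map Nat.succ + Multiset.replicate j 1) = t := by
  rw [Dm, Multiset.map_add, Multiset.map_map, Multiset.map_replicate, Multiset.filter_add]
  have e1 : (Multiset.replicate j (Nat.pred 1)).filter (fun x => x ≠ 0) = 0 := by
    rw [Multiset.filter_eq_nil]
    intro a ha
    have := Multiset.eq_of_mem_replicate ha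
    simp [this]
  have e2 : t.map (Nat.pred ∘ Nat.succ) = t := by
    conv_rhs => rw [← Multiset.map_id t]
    exact Multiset.map_congr rfl fun x _ => rfl
  rw [e1, e2, add_zero, Multiset.filter_eq_self]
  intro a ha h
  exact ht (h ▸ ha)

theorem Dm_card (s : Multiset ℕ) (hs : 0 ∉ s) : (Dm s).card + s.count 1 = s.card := by
  have := congrArg Multiset.card (Dm_add s hs)
  simpa using this

theorem map_succ_sum (t : Multiset ℕ) : (t.map Nat.succ).sum = t.sum + t.card := by
  induction t using Multiset.induction with
  | empty => simp
  | cons a t ih => simp [ih]; omega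

theorem Dm_sum (s : Multiset ℕ) (hs : 0 ∉ s) : (Dm s).sum + s.card = s.sum := by
  have := congrArg Multiset.sum (Dm_add s hs)
  rw [Multiset.sum_add, map_succ_sum, Multiset.sum_replicate, smul_eq_mul, mul_one] at this
  have := Dm_card s hs
  omega

theorem Dm_sup (s : Multiset ℕ) {i : ℕ} (hi : i ∈ Dm s) : i + 1 ≤ s.sup := by
  rw [Dm, Multiset.mem_filter, Multiset.mem_map] at hi
  obtain ⟨⟨a, ha, rfl⟩, h⟩ := hi
  have := Multiset.le_sup ha
  rw [Nat.pred_eq_sub_one] at *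
  omega

/-- rank on multisets -/
def mrk (s : Multiset ℕ) : ℤ := (s.sup : ℤ) - s.card

/-- Dyson map -/
def fwd (c : ℤ) (s : Multiset ℕ) : Multiset ℕ :=
  if ((s.card : ℤ) + c).toNat = 0 then Dm s else ((s.card : ℤ) + c).toNat ::ₘ Dm s

/-- inverse Dyson map -/
def bwd (c : ℤ) (t : Multiset ℕ) : Multiset ℕ :=
  (t.erase t.sup).map Nat.succ + Multiset.replicate ((t.sup : ℤ) - c - (t.erase t.sup).card).toNat 1

theorem sup_pos {s : Multiset ℕ} (h0 : 0 ∉ s) (hs : s ≠ 0) : 0 < s.sup :=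
  Nat.pos_of_ne_zero fun h => h0 (h ▸ sup_mem hs)

theorem fwd_facts {c : ℤ} (hc : 2 ≤ c ∨ c ≤ -2) {s : Multiset ℕ} (h0 : 0 ∉ s) (hr : mrk s ≤ c + 1) :
    0 ≤ (s.card : ℤ) + c ∧ (∀ i ∈ Dm s, i ≤ ((s.card : ℤ) + c).toNat) ∧ (((s.card : ℤ) + c).toNat = 0 → Dm s = 0) := by
  have p1 : 0 ≤ (s.card : ℤ) + c := by
    rcases eq_or_ne s 0 with rfl | hs
    · simp [mrk] at hr ⊢; omega
    · have := sup_pos h0 hs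
      rw [mrk] at hr; omega
  have p2 : ∀ i ∈ Dm s, i ≤ ((s.card : ℤ) + c).toNat := fun i hi => by
    have := Dm_sup s hi
    rw [mrk] at hr; omega
  refine ⟨p1, p2, fun h => ?_⟩
  by_contra h2
  obtain ⟨i, hi⟩ := Multiset.exists_mem_of_ne_zero h2
  have h3 := p2 i hi
  rw [h] at h3
  exact Dm_zero s (by rwa [show i = 0 by omega] at hi)

theorem fwd_sup {c : ℤ} (hc : 2 ≤ c ∨ c ≤ -2) {s : Multiset ℕ} (h0 : 0 ∉ s) (hr : mrk s ≤ c + 1) :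
    (fwd c s).sup = ((s.card : ℤ) + c).toNat ∧ (fwd c s).erase (fwd c s).sup = Dm s := by
  obtain ⟨p1, p2, p3⟩ := fwd_facts hc h0 hr
  rw [fwd]
  split_ifs with h
  · simp [p3 h, h]
  · have : (((s.card : ℤ) + c).toNat ::ₘ Dm s).sup = ((s.card : ℤ) + c).toNat := by
      rw [Multiset.sup_cons]
      exact max_eq_left (Multiset.sup_le.2 p2)
    rw [this, Multiset.erase_cons_head]
    exact ⟨rfl, rfl⟩

theorem fwd_zero {c : ℤ} {s : Multiset ℕ} : 0 ∉ fwd c s := by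
  rw [fwd]
  split_ifs with h
  · exact Dm_zero s
  · rw [Multiset.mem_cons, not_or]
    exact ⟨fun h' => h h'.symm, Dm_zero s⟩

theorem fwd_card {c : ℤ} {s : Multiset ℕ} (h0 : 0 ∉ s) : (fwd c s).card ≤ s.card + 1 := by
  have := Dm_card s h0
  rw [fwd]
  split_ifs with h
  · omega
  · rw [Multiset.card_cons]; omega

theorem fwd_rank {c : ℤ} (hc : 2 ≤ c ∨ c ≤ -2) {s : Multiset ℕ} (h0 : 0 ∉ s) (hr : mrk s ≤ c + 1) :
    c - 1 ≤ mrk (fwd c s) := by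
  obtain ⟨p1, p2, p3⟩ := fwd_facts hc h0 hr
  have := fwd_card (c := c) h0
  rw [mrk, (fwd_sup hc h0 hr).1]
  omega

theorem fwd_sum {c : ℤ} (hc : 2 ≤ c ∨ c ≤ -2) {s : Multiset ℕ} (h0 : 0 ∉ s) (hr : mrk s ≤ c + 1) :
    ((fwd c s).sum : ℤ) = s.sum + c := by
  obtain ⟨p1, p2, p3⟩ := fwd_facts hc h0 hr
  have := Dm_sum s h0
  rw [fwd]
  split_ifs with h
  · omega
  · rw [Multiset.sum_cons]; omega

theorem bwd_fwd {c : ℤ} (hc : 2 ≤ c ∨ c ≤ -2) {s : Multiset ℕ} (h0 : 0 ∉ s) (hr : mrk s ≤ c + 1) :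
    bwd c (fwd c s) = s := by
  obtain ⟨p1, p2, p3⟩ := fwd_facts hc h0 hr
  rw [bwd, (fwd_sup hc h0 hr).2, (fwd_sup hc h0 hr).1]
  conv_rhs => rw [← Dm_add s h0]
  congr 2
  have := Dm_card s h0
  omega

theorem bwd_zero {c : ℤ} {t : Multiset ℕ} : 0 ∉ bwd c t := by
  rw [bwd, Multiset.mem_add, not_or]
  constructor
  · simp
  · intro h
    exact absurd (Multiset.eq_of_mem_replicate h) (by simp)

theorem bwd_facts {c : ℤ} (hc : 2 ≤ c ∨ c ≤ -2) {t : Multiset ℕ} (hr : c - 1 ≤ mrk t) :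
    0 ≤ (t.sup : ℤ) - c - (t.erase t.sup).card := by
  rw [mrk] at hr
  rcases eq_or_ne t 0 with rfl | ht
  · simp at hr ⊢; omega
  · have := Multiset.card_erase_add_one (sup_mem ht)
    omega

theorem bwd_card {c : ℤ} (hc : 2 ≤ c ∨ c ≤ -2) {t : Multiset ℕ} (hr : c - 1 ≤ mrk t) :
    ((bwd c t).card : ℤ) = t.sup - c := by
  have := bwd_facts hc hr
  rw [bwd, Multiset.card_add, Multiset.card_map, Multiset.card_replicate]
  omega

theorem bwd_rank {c : ℤ} (hc : 2 ≤ c ∨ c ≤ -2) {t : Multiset ℕ} (hr : c - 1 ≤ mrk t) : mrk (bwd c t) ≤ c + 1 := by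
  rw [mrk, bwd_card hc hr]
  have : (bwd c t).sup ≤ t.sup + 1 := by
    rw [Multiset.sup_le]
    intro b hb
    rw [bwd, Multiset.mem_add, Multiset.mem_map] at hb
    rcases hb with ⟨a, ha, rfl⟩ | hb
    · have := Multiset.le_sup (Multiset.mem_of_mem_erase ha)
      omega
    · rw [Multiset.eq_of_mem_replicate hb]; omega
  omega

theorem fwd_bwd {c : ℤ} (hc : 2 ≤ c ∨ c ≤ -2) {t : Multiset ℕ} (h0 : 0 ∉ t) (hr : c - 1 ≤ mrk t) :
    fwd c (bwd c t) = t := by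
  have e : (((bwd c t).card : ℤ) + c).toNat = t.sup := by rw [bwd_card hc hr]; omega
  have e2 : Dm (bwd c t) = t.erase t.sup := by
    rw [bwd, Dm_succ]
    exact fun h => h0 (Multiset.mem_of_mem_erase h)
  rw [fwd, e, e2]
  rcases eq_or_ne t 0 with rfl | ht
  · simp
  · rw [if_neg (sup_pos h0 ht).ne', Multiset.cons_erase (sup_mem ht)]

/-- Dyson equivalence -/
def dyson (c : ℤ) (hc : 2 ≤ c ∨ c ≤ -2) :
    {s : Multiset ℕ | 0 ∉ s ∧ mrk s ≤ c + 1} ≃ {t : Multiset ℕ | 0 ∉ t ∧ c - 1 ≤ mrk t} where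
  toFun s := ⟨fwd c s.1, fwd_zero, fwd_rank hc s.2.1 s.2.2⟩
  invFun t := ⟨bwd c t.1, bwd_zero, bwd_rank hc t.2.2⟩
  left_inv s := Subtype.ext (bwd_fwd hc s.2.1 s.2.2)
  right_inv t := Subtype.ext (fwd_bwd hc t.2.1 t.2.2)

theorem dyson_gf {q : ℂ} (q0 : q ≠ 0) (c : ℤ) (hc : 2 ≤ c ∨ c ≤ -2) :
    ∑' s, pw q (fun s => if c - 1 ≤ mrk s then 1 else 0) s = q^c * ∑' s, pw q (fun s => if mrk s ≤ c + 1 then 1 else 0) s := by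
  classical
  have e1 : ∀ s, pw q (fun s => if c - 1 ≤ mrk s then 1 else 0) s = 
      Set.indicator {t : Multiset ℕ | 0 ∉ t ∧ c - 1 ≤ mrk t} (fun s => q^s.sum) s := by
    intro s
    by_cases h : 0 ∈ s <;> by_cases h2 : c - 1 ≤ mrk s <;> simp [pw, Set.indicator_apply, h, h2] <;> intros <;> exfalso <;> omega
  have e2 : ∀ s, pw q (fun s => if mrk s ≤ c + 1 then 1 else 0) s = 
      Set.indicator {t : Multiset ℕ | 0 ∉ t ∧ mrk t ≤ c + 1} (fun s => q^s.sum) s := by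
    intro s
    by_cases h : 0 ∈ s <;> by_cases h2 : mrk s ≤ c + 1 <;> simp [pw, h, h2]
  rw [tsum_congr e1, tsum_congr e2, ← tsum_subtype, ← tsum_subtype, ← (dyson c hc).tsum_eq, ← tsum_mul_left]
  refine tsum_congr fun s => ?_
  have := fwd_sum hc s.2.1 s.2.2
  rw [← zpow_natCast, ← zpow_natCast, ← zpow_add₀ q0]
  congr 1
  exact this.trans (Int.add_comm _ _)

/-- term of the rank series -/
noncomputable def rt (t : ℂ) (m k : ℕ) : ℂ := (-1)^k * t^((k+1)*(3*k+2)) * (t^(2*(k+1)))^m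

theorem rt_norm_le {t : ℂ} (h1 : ‖t‖ < 1) (m k : ℕ) : ‖rt t m k‖ ≤ ‖t‖^m * ‖t‖^k := by
  rw [rt, norm_mul, norm_mul, norm_pow, norm_neg, norm_one, one_pow, one_mul, norm_pow, ← pow_mul, norm_pow,
    ← pow_add, ← pow_add]
  exact pow_le_pow_of_le_one (norm_nonneg _) h1.le (by nlinarith)

theorem rt_summ {t : ℂ} (h1 : ‖t‖ < 1) (m : ℕ) : Summable fun k => rt t m k :=
  (Summable.of_nonneg_of_le (fun _ => norm_nonneg _) (rt_norm_le h1 m)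
    ((summable_geometric_of_lt_one (norm_nonneg t) h1).mul_left _)).of_norm

theorem rt_rec {t : ℂ} (h1 : ‖t‖ < 1) (m : ℕ) :
    ∑' k, rt t m k = (t^2)^(m+1) * (1 - ∑' k, rt t (m+3) k) := by
  rw [(rt_summ h1 m).tsum_eq_zero_add, mul_sub, ← tsum_mul_left, sub_eq_add_neg, ← tsum_neg]
  congr 1
  · rw [rt]; ring
  · refine tsum_congr fun k => ?_
    rw [rt, rt]; ring

theorem rec_unique {t P : ℂ} (h1 : ‖t‖ < 1) (x : ℕ → ℂ) (M : ℝ) (hM : ∀ m, ‖x m‖ ≤ M)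
    (hx : ∀ m, 1 ≤ m → x m = (t^2)^(m+1) * (P - x (m+3))) (m : ℕ) (hm : 1 ≤ m) :
    x m = P * ∑' k, rt t m k := by
  have b : ∀ m, ‖∑' k, rt t m k‖ ≤ ∑' k, ‖t‖^k := by
    intro m
    refine tsum_of_norm_bounded (summable_geometric_of_lt_one (norm_nonneg t) h1).hasSum fun k => ?_
    refine (rt_norm_le h1 m k).trans ?_
    exact mul_le_of_le_one_left (by positivity) (pow_le_one₀ (norm_nonneg _) h1.le)
  set B := M + ‖P‖ * ∑' k, ‖t‖^k with hB
  have hd : ∀ m, ‖x m - P * ∑' k, rt t m k‖ ≤ B := by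
    intro m
    refine (norm_sub_le _ _).trans ?_
    rw [norm_mul]
    exact add_le_add (hM m) (mul_le_mul_of_nonneg_left (b m) (norm_nonneg _))
  have B0 : 0 ≤ B := (norm_nonneg _).trans (hd 0)
  have st : ∀ m, 1 ≤ m → ‖x m - P * ∑' k, rt t m k‖ ≤ ‖t‖ * ‖x (m+3) - P * ∑' k, rt t (m+3) k‖ := by
    intro m hm
    have : x m - P * ∑' k, rt t m k = (t^2)^(m+1) * (-(x (m+3) - P * ∑' k, rt t (m+3) k)) := by
      rw [hx m hm, rt_rec h1]; ring
    rw [this, norm_mul, norm_neg, norm_pow, norm_pow, ← pow_mul]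
    refine mul_le_mul_of_nonneg_right ?_ (norm_nonneg _)
    exact pow_le_of_le_one (norm_nonneg _) h1.le (by omega)
  have it : ∀ N m, 1 ≤ m → ‖x m - P * ∑' k, rt t m k‖ ≤ ‖t‖^N * B := by
    intro N
    induction N with
    | zero => intro m _; simpa using hd m
    | succ N ih =>
      intro m hm
      refine (st m hm).trans ?_
      rw [pow_succ', mul_assoc]
      exact mul_le_mul_of_nonneg_left (ih _ (by omega)) (norm_nonneg _)
  have l : Tendsto (fun N => ‖t‖^N * B) atTop (𝓝 (0 * B)) :=
    (tendsto_pow_atTop_nhds_zero_of_lt_one (norm_nonneg t) h1).mul_const B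
  rw [zero_mul] at l
  have := ge_of_tendsto' l (fun N => it N m hm)
  exact sub_eq_zero.1 (norm_le_zero_iff.1 this)

/-- generating function of partitions satisfying p -/
noncomputable def gp (q : ℂ) (p : Multiset ℕ → Prop) [DecidablePred p] : ℂ :=
  ∑' s, pw q (fun s => if p s then 1 else 0) s

theorem gp_hs {q : ℂ} (hq : ‖q‖ < 1/2) (p : Multiset ℕ → Prop) [DecidablePred p] :
    HasSum (fun s => pw q (fun s => if p s then 1 else 0) s) (gp q p) :=
  (pw_norm (C := 1) hq (fun s => by split_ifs <;> simp)).of_norm.hasSum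

theorem gp_bound {q : ℂ} (hq : ‖q‖ < 1/2) (p : Multiset ℕ → Prop) [DecidablePred p] :
    ‖gp q p‖ ≤ ∑' s, ‖pw q (fun _ => 1) s‖ := by
  refine tsum_of_norm_bounded (pw_norm (C := 1) hq (f := fun _ => 1) (fun _ => by simp)).hasSum fun s => ?_
  rw [pw, pw]
  split_ifs <;> simp

theorem gp_sub {q : ℂ} (hq : ‖q‖ < 1/2) (p p' r : Multiset ℕ → Prop) [DecidablePred p] [DecidablePred p'] [DecidablePred r]
    (h1 : ∀ s, p s ↔ (p' s ∨ r s)) (h2 : ∀ s, p' s → r s → False) : gp q r = gp q p - gp q p' := by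
  refine (((gp_hs hq p).sub (gp_hs hq p')).cg (fun s => ?_) rfl).tsum_eq
  simp only [pw, h1]
  have := h2 s
  by_cases a : p' s <;> by_cases b : r s <;> simp [a, b]
  exact (this a b).elim

theorem U_val {t : ℂ} (t0 : t ≠ 0) (ht : ‖t‖ < 1) (hq : ‖t^2‖ < 1/2) (m : ℕ) (hm : 1 ≤ m) :
    gp (t^2) (fun s => (m:ℤ) ≤ mrk s) = gp (t^2) (fun _ => True) * ∑' k, rt t m k := by
  refine rec_unique ht (fun m => gp (t^2) (fun s => (m:ℤ) ≤ mrk s)) _ (fun m => gp_bound hq _) (fun m hm => ?_) m hm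
  have := dyson_gf (q := t^2) (by simp [t0]) (m+1) (by omega)
  simp only [add_sub_cancel_right] at this
  show gp _ _ = _
  rw [gp, this, ← gp_sub hq (fun _ => True) (fun s => ((m+3:ℕ):ℤ) ≤ mrk s) (fun s => mrk s ≤ (m:ℤ)+1+1)
    (fun s => by simp; omega) (fun s h => by omega)]
  rw [gp]
  congr 1

theorem L_val {t : ℂ} (t0 : t ≠ 0) (ht : ‖t‖ < 1) (hq : ‖t^2‖ < 1/2) (m : ℕ) (hm : 1 ≤ m) :
    gp (t^2) (fun s => mrk s ≤ -(m:ℤ)) = gp (t^2) (fun _ => True) * ∑' k, rt t m k := by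
  refine rec_unique ht (fun m => gp (t^2) (fun s => mrk s ≤ -(m:ℤ))) _ (fun m => gp_bound hq _) (fun m hm => ?_) m hm
  have := dyson_gf (q := t^2) (by simp [t0]) (-((m:ℤ)+1)) (by omega)
  have e : -((m:ℤ)+1)+1 = -(m:ℤ) := by ring
  rw [e] at this
  show gp _ _ = _
  rw [← gp_sub hq (fun _ => True) (fun s => mrk s ≤ -((m+3:ℕ):ℤ)) (fun s => -((m:ℤ)+1) - 1 ≤ mrk s)
    (fun s => by simp; omega) (fun s h => by omega)]
  rw [gp, gp, this, ← mul_assoc, zpow_neg, show (t^2)^((m:ℤ)+1) = (t^2)^(m+1) by norm_cast, mul_inv_cancel₀ (by simp [t0]), one_mul]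

theorem P_val {q : ℂ} (hq : ‖q‖ < 1/2) : gp q (fun _ => True) * qp q q = 1 := by
  have := (Fk_const (z := 1) hq (by simp)).1
  rw [one_mul] at this
  rw [← this, gp, Fk]
  congr 1
  refine tsum_congr fun s => ?_
  rw [pw, fk]
  have : (∀ i ∈ s, 0 < i) ↔ 0 ∉ s := by
    constructor
    · intro h h'; exact absurd (h _ h') (by simp)
    · intro h i hi; exact Nat.pos_of_ne_zero fun h' => h (h' ▸ hi)
  by_cases h : 0 ∈ s <;> simp [this, h]

theorem rank_sum {t : ℂ} (t0 : t ≠ 0) (ht : ‖t‖ < 1) (hq : ‖t^2‖ < 1/2) :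
    HasSum (fun j : ℕ => gp (t^2) (fun _ => True) * ((∑' k, rt t (8*j+1) k - ∑' k, rt t (8*j+2) k) +
      (∑' k, rt t (8*j+7) k - ∑' k, rt t (8*j+8) k))) (gp (t^2) (fun s => mrk s % 8 = 1)) := by
  have key := (tsum_fib (gp_hs hq (fun s => mrk s % 8 = 1)).summable (fun s => mrk s / 8)).nat_add_neg_add_one
  refine key.cg (fun j => ?_) (gp_hs hq (fun s => mrk s % 8 = 1)).tsum_eq.symm
  have f : ∀ r : ℤ, (∑' s, if mrk s / 8 = r then pw (t^2) (fun s => if mrk s % 8 = 1 then 1 else 0) s else 0) =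
      gp (t^2) (fun s => mrk s = 8 * r + 1) := by
    intro r
    rw [gp]
    refine tsum_congr fun s => ?_
    rw [pw, pw]
    have : mrk s = 8 * r + 1 ↔ (mrk s / 8 = r ∧ mrk s % 8 = 1) := by omega
    simp only [this]
    by_cases h : 0 ∈ s <;> by_cases h2 : mrk s / 8 = r <;> by_cases h3 : mrk s % 8 = 1 <;> simp [h, h2, h3]
  rw [f, f, mul_add, mul_sub, mul_sub, ← U_val t0 ht hq _ (by omega), ← U_val t0 ht hq _ (by omega), 
    ← L_val t0 ht hq _ (by omega), ← L_val t0 ht hq _ (by omega),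
    ← gp_sub hq _ _ (fun s => mrk s = 8 * (j:ℤ) + 1), ← gp_sub hq _ _ (fun s => mrk s = 8 * (-((j:ℤ)+1)) + 1)]
  all_goals intro s; try push_cast; omega

theorem rank_swap {t : ℂ} (ht : ‖t‖ < 1) :
    ∑' j : ℕ, ((∑' k, rt t (8*j+1) k - ∑' k, rt t (8*j+2) k) + (∑' k, rt t (8*j+7) k - ∑' k, rt t (8*j+8) k)) =
    ∑' k : ℕ, (-1)^k * t^((k+1)*(3*k+2)) * ((t^(2*(k+1))) * (1 - t^(2*(k+1))) * (1 + (t^(2*(k+1)))^6) / (1 - (t^(2*(k+1)))^8)) := by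
  have g := summable_geometric_of_lt_one (norm_nonneg t) ht
  have G : Summable fun p : ℕ × ℕ => ‖t‖^p.1 * ‖t‖^p.2 :=
    g.mul_of_nonneg g (fun _ => pow_nonneg (norm_nonneg _) _) (fun _ => pow_nonneg (norm_nonneg _) _)
  have sm : ∀ i : ℕ, Summable fun p : ℕ × ℕ => rt t (8*p.1+i) p.2 := by
    intro i
    have b : ∀ p : ℕ × ℕ, ‖rt t (8*p.1+i) p.2‖ ≤ ‖t‖^p.1 * ‖t‖^p.2 := fun p => by
      refine (rt_norm_le ht _ _).trans ?_
      refine mul_le_mul_of_nonneg_right ?_ (pow_nonneg (norm_nonneg _) _)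
      exact pow_le_pow_of_le_one (norm_nonneg _) ht.le (by omega)
    exact Summable.of_norm_bounded G b
  have S := (((sm 1).sub (sm 2)).add ((sm 7).sub (sm 8)))
  have e : ∀ j : ℕ, ((∑' k, rt t (8*j+1) k - ∑' k, rt t (8*j+2) k) + (∑' k, rt t (8*j+7) k - ∑' k, rt t (8*j+8) k)) =
      ∑' k, ((rt t (8*j+1) k - rt t (8*j+2) k) + (rt t (8*j+7) k - rt t (8*j+8) k)) := by
    intro j
    have r := fun m => rt_summ ht m
    rw [← (r _).tsum_sub (r _), ← (r _).tsum_sub (r _), ((r _).sub (r _)).tsum_add ((r _).sub (r _))]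
  rw [tsum_congr e]
  have := Summable.tsum_comm (f := fun j k : ℕ => ((rt t (8*j+1) k - rt t (8*j+2) k) + (rt t (8*j+7) k - rt t (8*j+8) k))) S
  rw [← this]
  refine tsum_congr fun k => ?_
  have hx : ‖(t^(2*(k+1)))^8‖ < 1 := by
    rw [← pow_mul, norm_pow]
    exact pow_lt_one₀ (norm_nonneg _) ht (by omega)
  have hs := (hasSum_geometric_of_norm_lt_one hx).mul_left ((-1)^k * t^((k+1)*(3*k+2)) * 
    ((t^(2*(k+1))) * (1 - t^(2*(k+1))) * (1 + (t^(2*(k+1)))^6)))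
  refine (hs.cg (fun j => ?_) ?_).tsum_eq
  · simp only [rt]
    generalize t^(2*(k+1)) = x
    rw [pow_add, pow_add, pow_add, pow_add, pow_mul]
    ring
  · rw [div_eq_mul_inv]; ring

theorem pair_id {t : ℂ} (t0 : t ≠ 0) (ht : ‖t‖ < 1) (k : ℕ) :
    (4 * gT t ((k+1:ℕ):ℤ) + 2 * kT t (-1) ((k+1:ℕ):ℤ)) + (4 * gT t (-((k+1:ℕ):ℤ)) + 2 * kT t (-1) (-((k+1:ℕ):ℤ))) =
    -8 * ((-1)^k * t^((k+1)*(3*k+2)) * ((t^(2*(k+1))) * (1 - t^(2*(k+1))) * (1 + (t^(2*(k+1)))^6) / (1 - (t^(2*(k+1)))^8))) := by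
  rw [gT, gT, kT, kT]
  have x0 : t^(2*(k+1)) ≠ 0 := pow_ne_zero _ t0
  have x8 : 1 - (t^(2*(k+1)))^8 ≠ 0 := by
    intro h
    have hx : ‖(t^(2*(k+1)))^8‖ < 1 := by
      rw [← pow_mul, norm_pow]
      exact pow_lt_one₀ (norm_nonneg _) ht (by omega)
    rw [← sub_eq_zero.1 h] at hx
    simp at hx
  have e1 : t^(2*((k+1:ℕ):ℤ)) = t^(2*(k+1)) := by norm_cast
  have e2 : t^(2*(-((k+1:ℕ):ℤ))) = (t^(2*(k+1)))⁻¹ := by rw [mul_neg, zpow_neg, e1]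
  have e3 : t^(((k+1:ℕ):ℤ)*(3*((k+1:ℕ):ℤ)+1)) = t^((k+1)*(3*k+2)) * (t^(2*(k+1))) := by
    rw [← pow_add, ← zpow_natCast]
    congr 1
    push_cast
    ring
  have e4 : t^((-((k+1:ℕ):ℤ))*(3*(-((k+1:ℕ):ℤ))+1)) = t^((k+1)*(3*k+2)) := by
    rw [← zpow_natCast]
    exact congrArg _ (by push_cast; ring)
  have e5 : (-1:ℂ)^((k+1:ℕ):ℤ) = -(-1)^k := by rw [zpow_natCast, pow_succ]; ring
  have e6 : (-1:ℂ)^(-((k+1:ℕ):ℤ)) = -(-1)^k := by rw [zpow_neg, e5]; rcases neg_one_pow_eq_or ℂ k with h | h <;> rw [h] <;> norm_num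
  rw [e1, e2, e3, e4, e5, e6]
  generalize t^(2*(k+1)) = x at *
  generalize t^((k+1)*(3*k+2)) = u
  generalize (-1:ℂ)^k = s
  have f : 1 - x^8 = (1-x)*(1+x)*(1+x^2)*(1+x^4) := by ring
  rw [f] at x8 ⊢
  have g1 : 1 - x ≠ 0 := fun h => x8 (by rw [h]; ring)
  have g2 : 1 + x ≠ 0 := fun h => x8 (by rw [h]; ring)
  have g3 : 1 + x^2 ≠ 0 := fun h => x8 (by rw [h]; ring)
  have g4 : 1 + x^4 ≠ 0 := fun h => x8 (by rw [h]; ring)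
  have a1 : (1 - x⁻¹)/(1 + x⁻¹^4) = x^3*(x-1)/(1+x^4) := by
    have : 1 + x⁻¹^4 = (1+x^4)/x^4 := by field_simp; ring
    rw [this]
    field_simp
  have a2 : 1 / (1 - (-1) * x⁻¹) = x / (1+x) := by
    have : 1 - (-1) * x⁻¹ = (1+x)/x := by field_simp; ring
    rw [this, one_div_div]
  have a3 : 1 - (-1) * x = 1 + x := by ring
  rw [mul_div_assoc (-s*u), a1, a3, div_eq_mul_one_div (-s*u), a2]
  field_simp
  ring

theorem rank8 {T : ℝ} (h0 : 0 < T) (h1 : T < 1) (hq : ‖(T:ℂ)^2‖ < 1/2) {z : ℂ} (hz : z^4 = -1) :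
    8 * gp ((T:ℂ)^2) (fun s => mrk s % 8 = 1) = (1 - (∑' n, 4 * gT T n) - 2 * ∑' n, kT T (-1) n) / qp ((T:ℂ)^2) ((T:ℂ)^2) := by
  have t0 : (T:ℂ) ≠ 0 := by exact_mod_cast h0.ne'
  have ht : ‖(T:ℂ)‖ < 1 := by simpa [abs_of_pos h0] using h1
  have sk := (kT_norm (bdm h0 h1)).of_norm.hasSum.mul_left 2
  have sg := (G_val h0 h1 hz).summable.hasSum
  have H := (sg.add sk).nat_add_neg
  have H2 := H.summable.tsum_eq_zero_add
  rw [H.tsum_eq, tsum_congr (pair_id t0 ht), tsum_mul_left (a := -8), ← rank_swap ht] at H2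
  have R := (rank_sum t0 ht hq).tsum_eq
  rw [tsum_mul_left] at R
  have P := P_val hq
  have E : qp ((T:ℂ)^2) ((T:ℂ)^2) ≠ 0 := right_ne_zero_of_mul_eq_one P
  have v0 : gT T 0 = 0 := by simp [gT]
  have v1 : kT T (-1) 0 = 1/2 := by simp [kT]; norm_num
  simp only [Nat.cast_zero, neg_zero, v0, v1] at H2
  rw [eq_div_iff E, ← R]
  linear_combination 8 * (∑' j : ℕ, ((∑' k, rt (T:ℂ) (8*j+1) k - ∑' k, rt (T:ℂ) (8*j+2) k) + (∑' k, rt (T:ℂ) (8*j+7) k - ∑' k, rt (T:ℂ) (8*j+8) k))) * P + H2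

theorem hs_mul {I J : Type*} {f : I → ℂ} {g : J → ℂ} {a b : ℂ} (hf : HasSum f a) (hg : HasSum g b) :
    HasSum (fun p : I × J => f p.1 * g p.2) (a * b) := by
  have G := hf.summable.norm.mul_of_nonneg hg.summable.norm (fun _ => norm_nonneg _) (fun _ => norm_nonneg _)
  have b : ∀ p : I × J, ‖f p.1 * g p.2‖ ≤ ‖f p.1‖ * ‖g p.2‖ := fun p => (norm_mul _ _).le
  exact hf.mul hg (Summable.of_norm_bounded G b)

theorem power_zero (b : ℕ → ℂ) (h : ∀ x : ℝ, 0 < x → x < 1/2 → HasSum (fun n => b n * (x:ℂ)^n) 0) (n : ℕ) : b n = 0 := by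
  induction n using Nat.strong_induction_on with
  | _ n ih =>
  have h2 : ∀ x : ℝ, 0 < x → x < 1/2 → HasSum (fun k => b (n+k) * (x:ℂ)^k) 0 := by
    intro x x0 x1
    have x0' : (x:ℂ) ≠ 0 := by exact_mod_cast x0.ne'
    have hh := h x x0 x1
    have inj : Function.Injective fun k : ℕ => n + k := fun a b hab => by simpa using hab
    have h3 := (inj.hasSum_iff (f := fun n => b n * (x:ℂ)^n) (a := 0) (fun m hm => ?_)).2 hh
    · refine (h3.mul_left ((x:ℂ)^n)⁻¹).cg (fun k => ?_) (by simp)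
      simp only [Function.comp]
      rw [pow_add]
      field_simp
    · have : m < n := by
        by_contra hc
        exact hm ⟨m - n, by simp; omega⟩
      simp only [ih m this, zero_mul]
  have sb := (h2 (1/4) (by norm_num) (by norm_num)).summable.norm
  have l : Tendsto (fun x : ℝ => ∑' k, b (n+k) * (x:ℂ)^k) (𝓝[>] 0) (𝓝 (∑' k, if k = 0 then b n else 0)) := by
    refine tendsto_tsum_of_dominated_convergence sb (fun k => ?_) ?_
    · have c : Continuous fun x : ℝ => b (n+k) * (x:ℂ)^k := by fun_prop
      have := (c.tendsto 0).mono_left (nhdsWithin_le_nhds (s := Set.Ioi 0))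
      rcases Nat.eq_zero_or_pos k with rfl | hk
      · simpa using this
      · simpa [hk.ne'] using this
    · have : Set.Ioo (0:ℝ) (1/4) ∈ 𝓝[>] (0:ℝ) := Ioo_mem_nhdsGT (by norm_num)
      filter_upwards [this] with x hx k
      rw [norm_mul, norm_mul, norm_pow, norm_pow]
      refine mul_le_mul_of_nonneg_left (pow_le_pow_left₀ (norm_nonneg _) ?_ k) (norm_nonneg _)
      rw [Complex.norm_real, Complex.norm_real, Real.norm_of_nonneg hx.1.le, Real.norm_of_nonneg (by norm_num)]
      exact hx.2.le
  rw [tsum_ite_eq] at l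
  refine tendsto_nhds_unique l (tendsto_const_nhds.congr' ?_)
  have : Set.Ioo (0:ℝ) (1/2) ∈ 𝓝[>] (0:ℝ) := Ioo_mem_nhdsGT (by norm_num)
  filter_upwards [this] with x hx
  exact (h2 x hx.1 hx.2).tsum_eq.symm

/-- power series in q without terms in classes 2, 3 mod 4 -/
def Good (F : ℝ → ℂ) : Prop := ∃ a : ℕ → ℂ, (∀ n, 2 ≤ n % 4 → a n = 0) ∧
  ∀ T : ℝ, 0 < T → T^2 < 1/2 → HasSum (fun n => a n * ((T:ℂ)^2)^n) (F T)

theorem good_family {I : Type*} (c : I → ℂ) (e : I → ℕ) (h : ∀ i, 2 ≤ e i % 4 → c i = 0) (F : ℝ → ℂ)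
    (hs : ∀ T : ℝ, 0 < T → T^2 < 1/2 → HasSum (fun i => c i * ((T:ℂ)^2)^(e i)) (F T)) : Good F := by
  refine ⟨fun n => ∑' i, if e i = n then c i else 0, fun n hn => ?_, fun T h0 h1 => ?_⟩
  · have z : ∀ i, (if e i = n then c i else 0) = 0 := by
      intro i
      split_ifs with hi
      · exact h i (hi ▸ hn)
      · rfl
    exact (tsum_congr z).trans tsum_zero
  · refine (tsum_fib (hs T h0 h1).summable e).cg (fun n => ?_) (hs T h0 h1).tsum_eq.symm
    rw [← tsum_mul_right]
    refine tsum_congr fun i => ?_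
    split_ifs with hi
    · rw [hi]
    · rw [zero_mul]

theorem Good.lin {F G : ℝ → ℂ} (hF : Good F) (hG : Good G) (u v : ℂ) : Good fun T => u * F T + v * G T := by
  obtain ⟨a, a0, ha⟩ := hF
  obtain ⟨b, b0, hb⟩ := hG
  refine ⟨fun n => u * a n + v * b n, fun n hn => by simp [a0 n hn, b0 n hn], fun T h0 h1 => ?_⟩
  exact (((ha T h0 h1).mul_left u).add ((hb T h0 h1).mul_left v)).cg (fun n => by ring) rfl

theorem T_facts {T : ℝ} (h0 : 0 < T) (hT : T^2 < 1/2) : (T:ℂ) ≠ 0 ∧ T < 1 ∧ ‖(T:ℂ)‖ < 1 ∧ ‖(T:ℂ)^2‖ < 1/2 := by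
  have : ‖(T:ℂ)‖ = T := by rw [Complex.norm_real, Real.norm_of_nonneg h0.le]
  have : T < 1 := by nlinarith
  refine ⟨by exact_mod_cast h0.ne', by nlinarith, by linarith, by rw [norm_pow]; simp_all⟩

theorem Good.mulP {F : ℝ → ℂ} (hF : Good F) : Good fun T => gp (((T:ℂ)^2)^4) (fun _ => True) * F T := by
  obtain ⟨a, a0, ha⟩ := hF
  refine good_family (I := Multiset ℕ × ℕ) (fun p => (if 0 ∈ p.1 then 0 else 1) * a p.2) (fun p => 4 * p.1.sum + p.2)
    (fun p hp => ?_) _ (fun T h0 h1 => ?_)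
  · rw [a0 p.2 (by omega), mul_zero]
  · obtain ⟨t0, -, t1, tq⟩ := T_facts h0 h1
    have q4 : ‖((T:ℂ)^2)^4‖ < 1/2 := by
      rw [norm_pow]
      exact (pow_le_of_le_one (norm_nonneg _) (by linarith) (by norm_num)).trans_lt tq
    have A := gp_hs q4 (fun _ => True)
    have B := ha T h0 h1
    refine (hs_mul A B).cg (fun p => ?_) rfl
    simp only [pw, if_true]
    rw [pow_add, pow_mul]
    split_ifs <;> ring

theorem zq {t : ℂ} (m : ℤ) (n : ℕ) (h : m = 2 * n) : t ^ m = (t^2)^n := by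
  rw [h, ← pow_mul, ← zpow_natCast]
  push_cast
  rfl

theorem neg_one_zpow_norm (n : ℤ) : ‖(-1:ℂ)^n‖ = 1 := by simp

theorem goodA : Good fun T => 4 * phip T * Thm T + 4 * phim T * Thp T := by
  refine good_family (I := ℤ × ℤ) (fun p => 4 * ((-1)^p.2 + (-1)^p.1)) (fun p => (p.1^2 + 8*p.2^2+6*p.2+1).toNat)
    (fun p hp => ?_) _ (fun T h0 h1 => ?_)
  · obtain ⟨n, k⟩ := p
    simp only at hp ⊢
    have pos : 0 ≤ n^2 + 8*k^2+6*k+1 := by nlinarith [sq_nonneg n, sq_nonneg (8*k+3)]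
    have hp : 2 ≤ (n^2 + 8*k^2+6*k+1) % 4 := by omega
    obtain ⟨a, ha⟩ := Int.even_or_odd' n
    obtain ⟨b, hb⟩ := Int.even_or_odd' k
    rcases ha with rfl | rfl <;> rcases hb with rfl | rfl
    · exfalso
      rw [show (2*a)^2 + 8*(2*b)^2+6*(2*b)+1 = 4*(a^2+8*b^2+3*b) + 1 by ring] at hp
      omega
    · rw [zpow_add₀ (by norm_num), zpow_mul, zpow_mul]; norm_num
    · rw [zpow_add₀ (by norm_num), zpow_mul, zpow_mul]; norm_num
    · exfalso
      rw [show (2*a+1)^2 + 8*(2*b+1)^2+6*(2*b+1)+1 = 4*(a^2+a+8*b^2+11*b+4) by ring] at hp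
      omega
  · obtain ⟨t0, -, t1, tq⟩ := T_facts h0 h1
    have s1 : Summable fun l : ℤ => ‖(-1:ℂ)^l * (T:ℂ)^(2*l^2)‖ :=
      (summable_zg t0 t1 2 0 0 (by norm_num)).congr fun l => by
        rw [show 2*l^2+0*l+0 = 2*l^2 by ring]
    have s2 : Summable fun l : ℤ => ‖(T:ℂ)^(2*l^2)‖ := s1.congr fun l => by
      rw [norm_mul, neg_one_zpow_norm, one_mul]
    have s3 : Summable fun l : ℤ => ‖(-1:ℂ)^l * (T:ℂ)^((4*l+2)*(4*l+1))‖ :=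
      (summable_zg t0 t1 16 12 2 (by norm_num)).congr fun l => by
        rw [show 16*l^2+12*l+2 = (4*l+2)*(4*l+1) by ring]
    have s4 : Summable fun l : ℤ => ‖(T:ℂ)^((4*l+2)*(4*l+1))‖ := s3.congr fun l => by
      rw [norm_mul, neg_one_zpow_norm, one_mul]
    have A := hs_mul s2.of_norm.hasSum s3.of_norm.hasSum
    have B := hs_mul s1.of_norm.hasSum s4.of_norm.hasSum
    refine ((A.add B).mul_left 4).cg (fun p => ?_) ?_
    · obtain ⟨n, k⟩ := p
      simp only
      have pos : 0 ≤ n^2 + 8*k^2+6*k+1 := by nlinarith [sq_nonneg n, sq_nonneg (8*k+3)]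
      rw [← zq (2*n^2 + (4*k+2)*(4*k+1)) _ (by rw [Int.toNat_of_nonneg pos]; ring), zpow_add₀ t0]
      ring
    · rw [phip, Thm, phim, Thp]; ring

/-- absolute exponent -/
def wt (s : ℤ) : ℕ := (4*s+1).natAbs
/-- shift -/
def dl (s : ℤ) : ℕ := if s < 0 then wt s else 0

theorem wt_pos (s : ℤ) : 1 ≤ wt s := by rw [wt]; omega

theorem exN (s : ℤ) : 0 ≤ 6*s^2+6*s+1 := by
  rcases le_or_gt 0 s with h | h <;> nlinarith

theorem pN_q (t : ℂ) (s : ℤ) : pN t s = (-1)^s * (t^2)^(6*s^2+6*s+1).toNat := by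
  rw [pN, zq (t := t) (12*s^2+12*s+2) (6*s^2+6*s+1).toNat]
  rw [Int.toNat_of_nonneg (exN s)]; ring

theorem bB_summ {T : ℝ} (h0 : 0 < T) (h1 : T^2 < 1/2) (i : ℕ) :
    Summable fun p : ℤ × ℕ => pN T p.1 * ((T:ℂ)^2)^(dl p.1 + (4*p.2+3*i) * wt p.1) := by
  obtain ⟨t0, -, t1, tq⟩ := T_facts h0 h1
  have G := (pN_norm t0 t1).mul_of_nonneg (summable_geometric_of_lt_one (norm_nonneg ((T:ℂ)^2)) (by linarith))
    (fun _ => norm_nonneg _) (fun _ => pow_nonneg (norm_nonneg _) _)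
  have b : ∀ p : ℤ × ℕ, ‖pN T p.1 * ((T:ℂ)^2)^(dl p.1 + (4*p.2+3*i) * wt p.1)‖ ≤ ‖pN T p.1‖ * ‖(T:ℂ)^2‖^p.2 := by
    intro p
    rw [norm_mul, norm_pow ((T:ℂ)^2)]
    refine mul_le_mul_of_nonneg_left ?_ (norm_nonneg _)
    refine pow_le_pow_of_le_one (norm_nonneg _) (by linarith) ?_
    have := wt_pos p.1
    nlinarith [Nat.zero_le (dl p.1)]
  exact Summable.of_norm_bounded G b

theorem goodB (i : ℕ) (hi : i < 2) :
    Good fun T => ∑' p : ℤ × ℕ, pN T p.1 * ((T:ℂ)^2)^(dl p.1 + (4*p.2+3*i) * wt p.1) := by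
  refine good_family (I := ℤ × ℕ) (fun p => (-1)^p.1) (fun p => (6*p.1^2+6*p.1+1).toNat + (dl p.1 + (4*p.2+3*i) * wt p.1))
    (fun p hp => ?_) _ (fun T h0 h1 => ?_)
  · exfalso
    obtain ⟨s, j⟩ := p
    simp only at hp
    have e1 : (6*s^2+6*s+1).toNat % 4 = 1 := by
      have := exN s
      obtain ⟨a, ha⟩ := Int.even_mul_succ_self s
      have : 6*s^2+6*s+1 = 4*(3*a)+1 := by linear_combination 6 * ha
      omega
    have e2 : (dl s + (4*j+3*i) * wt s) % 4 = (dl s + 3*i*wt s) % 4 := by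
      rw [show dl s + (4*j+3*i) * wt s = (dl s + 3*i*wt s) + 4 * (j * wt s) by ring, Nat.add_mul_mod_self_left]
    have e3 : (dl s + 3*i*wt s) % 4 = 0 ∨ (dl s + 3*i*wt s) % 4 = 3 := by
      rw [dl]
      interval_cases i <;> split_ifs <;> rw [wt] <;> omega
    omega
  · refine (bB_summ h0 h1 i).hasSum.cg (fun p => ?_) rfl
    rw [pN_q, pow_add]; ring

theorem third {T : ℝ} (h0 : 0 < T) (h1 : T^2 < 1/2) :
    ∑' s : ℤ, pN T s * (1 - (T:ℂ)^(3*(8*s+2)))/(1 - (T:ℂ)^(4*(8*s+2))) =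
    ∑' p : ℤ × ℕ, pN T p.1 * ((T:ℂ)^2)^(dl p.1 + (4*p.2+3*0) * wt p.1) -
      ∑' p : ℤ × ℕ, pN T p.1 * ((T:ℂ)^2)^(dl p.1 + (4*p.2+3*1) * wt p.1) := by
  obtain ⟨t0, -, t1, tq⟩ := T_facts h0 h1
  have S := (bB_summ h0 h1 0).sub (bB_summ h0 h1 1)
  rw [← (bB_summ h0 h1 0).tsum_sub (bB_summ h0 h1 1), S.tsum_prod]
  refine tsum_congr fun s => ?_
  simp only []
  have hv : ‖(((T:ℂ)^2)^(wt s))^4‖ < 1 := by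
    rw [← pow_mul, norm_pow ((T:ℂ)^2)]
    have := wt_pos s
    exact pow_lt_one₀ (norm_nonneg _) (by linarith) (by omega)
  have v0 : ((T:ℂ)^2)^(wt s) ≠ 0 := pow_ne_zero _ (pow_ne_zero _ t0)
  have v4 : 1 - (((T:ℂ)^2)^(wt s))^4 ≠ 0 := by
    intro h
    rw [← sub_eq_zero.1 h] at hv
    simp at hv
  have y3 : (T:ℂ)^(3*(8*s+2)) = ((T:ℂ)^(8*s+2))^3 := by rw [mul_comm, zpow_mul]; norm_cast
  have y4 : (T:ℂ)^(4*(8*s+2)) = ((T:ℂ)^(8*s+2))^4 := by rw [mul_comm, zpow_mul]; norm_cast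
  have hs := (hasSum_geometric_of_norm_lt_one hv).mul_left (pN T s * ((T:ℂ)^2)^(dl s) * (1 - (((T:ℂ)^2)^(wt s))^3))
  symm
  refine (hs.cg (fun j => ?_) ?_).tsum_eq
  · rw [pow_add, pow_add, add_mul, add_mul, pow_add, pow_add]
    rw [show 4*j*wt s = wt s * (4 * j) by ring, pow_mul _ (wt s), pow_mul _ 4 j, show 3*1*wt s = wt s * 3 by ring, pow_mul _ (wt s) 3]
    rw [mul_zero, zero_mul, pow_zero]
    ring
  · rw [y3, y4]
    rcases lt_or_ge s 0 with h | h
    · have : (T:ℂ)^(8*s+2) = (((T:ℂ)^2)^(wt s))⁻¹ := by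
        rw [← zq (-(8*s+2)) (wt s) (by rw [wt]; omega), zpow_neg, inv_inv]
      rw [this, dl, if_pos h]
      generalize ((T:ℂ)^2)^(wt s) = v at *
      generalize pN T s = p
      have v5 : v^4 - 1 ≠ 0 := fun h => v4 (by linear_combination -h)
      have e1 : 1 - v⁻¹^4 = (v^4-1)/v^4 := by field_simp
      rw [e1]
      field_simp
      ring
    · have : (T:ℂ)^(8*s+2) = (((T:ℂ)^2)^(wt s)) := zq (8*s+2) (wt s) (by rw [wt]; omega)
      rw [this, dl, if_neg (by omega)]
      rw [div_eq_mul_inv, pow_zero, mul_one]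

theorem goodR : Good fun T => 4 * phip T * Thm T + 4 * phim T * Thp T - 
    8 * (∑' p : ℤ × ℕ, pN T p.1 * ((T:ℂ)^2)^(dl p.1 + (4*p.2+3*0) * wt p.1) -
      ∑' p : ℤ × ℕ, pN T p.1 * ((T:ℂ)^2)^(dl p.1 + (4*p.2+3*1) * wt p.1)) := by
  have := goodA.lin ((goodB 0 (by norm_num)).lin (goodB 1 (by norm_num)) 1 (-1)) 1 (-8)
  refine cast (congrArg Good (funext fun T => ?_)) this
  ring

theorem ex_z : ∃ z : ℂ, z^4 = -1 := by
  obtain ⟨z, hz⟩ := IsAlgClosed.exists_pow_nat_eq (-1:ℂ) (n := 4) (by norm_num)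
  exact ⟨z, hz⟩

theorem good_diff : Good fun T => 8 * (gp ((T:ℂ)^2) (fun s => mrk s % 8 = 1) - gp ((T:ℂ)^2) (fun s => mcr s % 8 = 2)) := by
  obtain ⟨a, a0, ha⟩ := goodR.mulP
  refine ⟨a, a0, fun T h0 h1 => ?_⟩
  refine (ha T h0 h1).cg (fun _ => rfl) ?_
  obtain ⟨z, hz⟩ := ex_z
  obtain ⟨t0, T1, t1, tq⟩ := T_facts h0 h1
  have q4 : ‖((T:ℂ)^2)^4‖ < 1/2 := by
    rw [norm_pow]
    exact (pow_le_of_le_one (norm_nonneg _) (by linarith) (by norm_num)).trans_lt tq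
  have M := main_id h0 T1 (q := (T:ℂ)^2) rfl
  rw [third h0 h1] at M
  have P := P_val q4
  have R := rank8 h0 T1 tq hz
  have C := crank8 tq hz
  simp only [← M]
  rw [show ((((T:ℂ)^2)^2)^2) = ((T:ℂ)^2)^4 by ring, ← mul_assoc, P, one_mul, mul_sub, R]
  rw [gp, C]
  ring

theorem final (n : ℕ) (hn : 2 ≤ n % 4) : 
    (Finset.univ.filter (fun π : n.Partition => mrk π.parts % 8 = 1)).card = (Finset.univ.filter (fun π : n.Partition => mcr π.parts % 8 = 2)).card := by
  obtain ⟨a, a0, ha⟩ := good_diff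
  have key := power_zero (fun n => 8 * ((∑ p : n.Partition, if mrk p.parts % 8 = 1 then (1:ℂ) else 0) - 
    (∑ p : n.Partition, if mcr p.parts % 8 = 2 then (1:ℂ) else 0)) - a n) (fun x x0 x1 => ?_) n
  · simp only [a0 n hn, sub_zero, Finset.sum_boole] at key
    have := (mul_eq_zero.1 key).resolve_left (by norm_num)
    exact_mod_cast sub_eq_zero.1 this
  · have hs : (Real.sqrt x)^2 = x := Real.sq_sqrt x0.le
    have hs' : ((Real.sqrt x : ℝ):ℂ)^2 = (x:ℂ) := by rw [← Complex.ofReal_pow, hs]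
    have H := ha (Real.sqrt x) (Real.sqrt_pos.2 x0) (by rw [hs]; exact x1)
    rw [hs'] at H
    have tq : ‖(x:ℂ)‖ < 1/2 := by rw [Complex.norm_real, Real.norm_of_nonneg x0.le]; exact x1
    have A := pw_gf (C := 1) tq (f := fun s => if mrk s % 8 = 1 then 1 else 0) (fun s => by split_ifs <;> simp)
    have B := pw_gf (C := 1) tq (f := fun s => if mcr s % 8 = 2 then 1 else 0) (fun s => by split_ifs <;> simp)
    refine (((A.sub B).mul_left 8).sub H).cg (fun n => by ring) ?_
    simp only [gp, hs']
    ring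

theorem stmt_19 : ∀ n : ℕ,
    rankCount 1 8 (4 * n + 2) = crankCount 2 8 (4 * n + 2) ∧
    rankCount 1 8 (4 * n + 3) = crankCount 2 8 (4 * n + 3) := by
  have h1 : ∀ n : ℕ, 2 ≤ n % 4 → rankCount 1 8 n = crankCount 2 8 n := fun n hn => final n hn
  exact fun n => ⟨h1 _ (by omega), h1 _ (by omega)⟩
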